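/- arXiv:math/0703926 — 2 statements merged into one kernel-verified Lean document; each statement's English description precedes it below -/
import Mathlib

section
/- Let A be a finite generating set for the discrete Heisenberg group H, and for n ∈ ℕ ∪ {0} set I_A(n) = max{|k| : k ∈ ℤ, |z^k|_A = n}. Then there exist real numbers D, E, F with E > 0, and for each n ∈ ℕ ∪ {0} a word w_n in the letters of A ∪ A⁻¹, such that: (1) w_n has length 2n; (2) each w_{n} (n ≥ 1) is obtained from w_{n−1} by inserting one letter of A ∪ A⁻¹ and its inverse (not necessarily adjacently to each other); (3) each w_n represents z^{k_n} for some k_n ∈ ℤ satisfying I_A(2n) − Dn ≤ k_n ≤ I_A(2n) and En² − Fn ≤ k_n ≤ En². -/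
/-- The discrete Heisenberg group `H = ⟨x,y | [x,[x,y]], [y,[x,y]]⟩`, realized as triples
`⟨a, b, c⟩` of integers (the unitriangular 3×3 integer matrix with superdiagonal `a, b` and
corner `c`), so that `x = ⟨1,0,0⟩`, `y = ⟨0,1,0⟩` and `x^i * y^j * z^k = ⟨i, j, i*j + k⟩`. -/
@[ext] structure Heis where
  a : ℤ
  b : ℤ
  c : ℤ

namespace Heis

instance : Mul Heis := ⟨fun g h => ⟨g.a + h.a, g.b + h.b, g.c + h.c + g.a * h.b⟩⟩
instance : One Heis := ⟨⟨0, 0, 0⟩⟩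
instance : Inv Heis := ⟨fun g => ⟨-g.a, -g.b, g.a * g.b - g.c⟩⟩

@[simp] lemma mul_a (g h : Heis) : (g * h).a = g.a + h.a := rfl
@[simp] lemma mul_b (g h : Heis) : (g * h).b = g.b + h.b := rfl
@[simp] lemma mul_c (g h : Heis) : (g * h).c = g.c + h.c + g.a * h.b := rfl
@[simp] lemma one_a : (1 : Heis).a = 0 := rfl
@[simp] lemma one_b : (1 : Heis).b = 0 := rfl
@[simp] lemma one_c : (1 : Heis).c = 0 := rfl
@[simp] lemma inv_a (g : Heis) : g⁻¹.a = -g.a := rfl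
@[simp] lemma inv_b (g : Heis) : g⁻¹.b = -g.b := rfl
@[simp] lemma inv_c (g : Heis) : g⁻¹.c = g.a * g.b - g.c := rfl

instance : Group Heis where
  mul_assoc g h k := by ext <;> simp <;> ring
  one_mul g := by ext <;> simp
  mul_one g := by ext <;> simp
  inv_mul_cancel g := by ext <;> simp

/-- The standard generator `x` of the Heisenberg group. -/
def x : Heis := ⟨1, 0, 0⟩
/-- The standard generator `y` of the Heisenberg group. -/
def y : Heis := ⟨0, 1, 0⟩
/-- The central element `z = [x,y] = x⁻¹y⁻¹xy`, generating the center; every element of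
`Heis` is uniquely of the form `x^i * y^j * z^k`. -/
def z : Heis := ⟨0, 0, 1⟩

/-- The abelianization map `φ : Heis → Heis_ab ≅ ℤ²`, sending `x^i y^j z^k` to `(i,j)`. -/
def φ (g : Heis) : ℤ × ℤ := (g.a, g.b)

/-- The exponent of `z` in the normal form of `g`:  the unique `k` with
`g = x^i * y^j * z^k` (where `(i,j) = φ g`). -/
def zexp (g : Heis) : ℤ := g.c - g.a * g.b

end Heis

/-- `A` is a generating set of the group `G`. -/
def IsGenSet {G : Type*} [Group G] (A : Finset G) : Prop :=
  Subgroup.closure (A : Set G) = ⊤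

/-- A word in the letters of `A ∪ A⁻¹`. -/
def IsWordOn {G : Type*} [Group G] (A : Finset G) (w : List G) : Prop :=
  ∀ a ∈ w, a ∈ A ∨ a⁻¹ ∈ A

/-- The word length `|g|_A` of `g` with respect to the finite generating set `A`:
the length of a shortest word in the letters of `A` and their inverses representing `g`. -/
noncomputable def wlen {G : Type*} [Group G] (A : Finset G) (g : G) : ℕ :=
  sInf {n | ∃ w : List G, IsWordOn A w ∧ w.length = n ∧ w.prod = g}

/-- `I_A(n) = max {|k| : |z^k|_A = n}`. -/
noncomputable def IA (A : Finset Heis) (n : ℕ) : ℕ :=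
  sSup {m : ℕ | ∃ k : ℤ, k.natAbs = m ∧ wlen A (Heis.z ^ k) = n}

namespace HF

/-- The symplectic form on the abelianization. -/
def wedge (g h : Heis) : ℤ := g.a * h.b - g.b * h.a

/-- Twice the symmetrised central coordinate. -/
def tt (g : Heis) : ℤ := 2 * g.c - g.a * g.b

/-- Sum of `wedge` over ordered pairs of letters. -/
def W : List Heis → ℤ
  | [] => 0
  | a :: u => wedge a u.prod + W u

def Closed (u : List Heis) : Prop := u.prod.a = 0 ∧ u.prod.b = 0

@[simp] lemma W_nil : W [] = 0 := rfl
@[simp] lemma W_cons (a : Heis) (u : List Heis) : W (a :: u) = wedge a u.prod + W u := rfl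

lemma tt_mul (g h : Heis) : tt (g * h) = tt g + tt h + wedge g h := by
  simp [tt, wedge]; ring

lemma tt_inv (g : Heis) : tt g⁻¹ = - tt g := by simp [tt]; ring
@[simp] lemma tt_one : tt 1 = 0 := by simp [tt]

lemma wedge_mul_right (g h k : Heis) : wedge g (h * k) = wedge g h + wedge g k := by
  simp [wedge]; ring
lemma wedge_mul_left (g h k : Heis) : wedge (g * h) k = wedge g k + wedge h k := by
  simp [wedge]; ring
@[simp] lemma wedge_one_right (g : Heis) : wedge g 1 = 0 := by simp [wedge]
@[simp] lemma wedge_one_left (g : Heis) : wedge 1 g = 0 := by simp [wedge]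
lemma wedge_inv_left (g h : Heis) : wedge g⁻¹ h = - wedge g h := by simp [wedge]; ring
lemma wedge_inv_right (g h : Heis) : wedge g h⁻¹ = - wedge g h := by simp [wedge]; ring
lemma wedge_self (g : Heis) : wedge g g = 0 := by simp [wedge]; ring
lemma wedge_swap (g h : Heis) : wedge g h = - wedge h g := by simp [wedge]; ring

lemma W_append (u v : List Heis) : W (u ++ v) = W u + W v + wedge u.prod v.prod := by
  induction u with
  | nil => simp
  | cons a u ih => simp [ih, wedge_mul_right, wedge_mul_left]; ring

lemma tt_prod (u : List Heis) : tt u.prod = (u.map tt).sum + W u := by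
  induction u with
  | nil => simp
  | cons a u ih => simp [tt_mul, ih]; ring

lemma zpow_z (k : ℤ) : Heis.z ^ k = (⟨0, 0, k⟩ : Heis) := by
  have hn : ∀ n : ℕ, Heis.z ^ n = (⟨0, 0, n⟩ : Heis) := by
    intro n
    induction n with
    | zero => rfl
    | succ n ih => rw [pow_succ, ih]; ext <;> simp [Heis.z]
  cases k with
  | ofNat n => simpa using hn n
  | negSucc n =>
    rw [zpow_negSucc, hn]
    ext <;> simp [Int.negSucc_eq]

lemma closed_prod {u : List Heis} (h : Closed u) : ∃ k : ℤ, u.prod = Heis.z ^ k ∧ tt u.prod = 2 * k := by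
  refine ⟨u.prod.c, ?_, ?_⟩
  · rw [zpow_z]; ext
    · exact h.1
    · exact h.2
    · rfl
  · simp [tt, h.1]

lemma closed_of_prod {u : List Heis} {k : ℤ} (h : u.prod = Heis.z ^ k) :
    Closed u ∧ tt u.prod = 2 * k := by
  rw [zpow_z] at h
  simp [Closed, h, tt]

lemma wedge_closed_right (g : Heis) {u : List Heis} (h : Closed u) : wedge g u.prod = 0 := by
  simp [wedge, h.1, h.2]

/-- If `u ++ v` is closed, `W` splits. -/
lemma W_split {u v : List Heis} (h : Closed (u ++ v)) : W (u ++ v) = W u + W v := by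
  rw [W_append]
  have h1 := h.1
  have h2 := h.2
  simp at h1 h2
  have : wedge u.prod v.prod = 0 := by
    have e1 : v.prod.a = - u.prod.a := by linarith
    have e2 : v.prod.b = - u.prod.b := by linarith
    simp [wedge, e1, e2]; ring
  rw [this]; ring

/-- Inserting a letter and its inverse. -/
lemma insert_pair (al be v : List Heis) (g : Heis) (h : Closed (al ++ be ++ v)) :
    Closed (al ++ g :: (be ++ g⁻¹ :: v)) ∧
    tt (al ++ g :: (be ++ g⁻¹ :: v)).prod = tt (al ++ be ++ v).prod + 2 * wedge g be.prod := by
  refine ⟨⟨?_, ?_⟩, ?_⟩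
  · have := h.1
    simp at this ⊢; linarith
  · have := h.2
    simp at this ⊢; linarith
  · have e1 := h.1
    have e2 := h.2
    simp at e1 e2
    simp [tt_mul, wedge_mul_right, tt_inv, wedge_inv_left, wedge_inv_right,
      wedge_self]
    rw [wedge_swap be.prod g]
    ring

lemma prod_map_inv_ab (u : List Heis) :
    (u.map (·⁻¹)).prod.a = - u.prod.a ∧ (u.map (·⁻¹)).prod.b = - u.prod.b := by
  induction u with
  | nil => simp
  | cons a u ih => simp at ih ⊢; constructor <;> linarith [ih.1, ih.2]

lemma W_map_inv (u : List Heis) : W (u.map (·⁻¹)) = W u := by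
  induction u with
  | nil => simp
  | cons a u ih =>
    have := prod_map_inv_ab u
    simp only [List.map_cons, W_cons, ih]
    simp only [wedge, this.1, this.2, Heis.inv_a, Heis.inv_b]
    ring

lemma sym_prod (u : List Heis) : (u ++ u.map (·⁻¹)).prod = Heis.z ^ (W u) := by
  have h := prod_map_inv_ab u
  have hc : Closed (u ++ u.map (·⁻¹)) := by
    constructor
    · rw [List.prod_append, Heis.mul_a, h.1]; ring
    · rw [List.prod_append, Heis.mul_b, h.2]; ring
  obtain ⟨k, hk, hk2⟩ := closed_prod hc
  rw [hk]
  congr 1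
  rw [tt_prod, W_split hc, W_map_inv] at hk2
  have : ((u ++ u.map (·⁻¹)).map tt).sum = 0 := by
    have e : ∀ u : List Heis, ((u.map (·⁻¹)).map tt).sum = - (u.map tt).sum := by
      intro u
      induction u with
      | nil => simp
      | cons a u ih =>
        simp only [List.map_cons, List.sum_cons, ih, tt_inv]; ring
    rw [List.map_append, List.sum_append, e]; ring
  rw [this] at hk2
  linarith

lemma tt_pow_ab (g : Heis) (n : ℕ) : (g ^ n).a = n * g.a ∧ (g ^ n).b = n * g.b ∧
    tt (g ^ n) = n * tt g := by
  induction n with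
  | zero => simp
  | succ n ih =>
    refine ⟨?_, ?_, ?_⟩
    · rw [pow_succ, Heis.mul_a, ih.1]; push_cast; ring
    · rw [pow_succ, Heis.mul_b, ih.2.1]; push_cast; ring
    · rw [pow_succ, tt_mul, ih.2.2]
      have : wedge (g ^ n) g = 0 := by simp [wedge, ih.1, ih.2.1]; ring
      rw [this]; push_cast; ring

/-- Changing the multiplicity of the letters of a sublist: the value is quadratic. -/
lemma sublist_quad {l w : List Heis} (h : l.Sublist w) :
    ∃ Δ : ℤ, ∀ j : ℤ, -1 ≤ j → ∃ w' : List Heis, (∀ a ∈ w', a ∈ w) ∧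
      (w'.length : ℤ) = w.length + j * l.length ∧
      w'.prod.a = w.prod.a + j * l.prod.a ∧ w'.prod.b = w.prod.b + j * l.prod.b ∧
      tt w'.prod = tt w.prod + j * Δ + j ^ 2 * W l := by
  induction h with
  | slnil => exact ⟨0, fun j _ => ⟨[], by simp⟩⟩
  | @cons l w a h ih =>
    obtain ⟨Δ, hΔ⟩ := ih
    refine ⟨Δ + wedge a l.prod, fun j hj => ?_⟩
    obtain ⟨w', h1, h2, h3, h4, h5⟩ := hΔ j hj
    refine ⟨a :: w', ?_, ?_, ?_, ?_, ?_⟩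
    · intro b hb
      simp at hb ⊢
      exact hb.imp id (h1 b)
    · simp [h2]; ring
    · simp [h3]; ring
    · simp [h4]; ring
    · simp only [List.prod_cons, tt_mul, h5]
      simp only [wedge, h3, h4]; ring
  | @cons_cons l w a h ih =>
    obtain ⟨Δ, hΔ⟩ := ih
    refine ⟨tt a + Δ + wedge a w.prod + wedge a l.prod, fun j hj => ?_⟩
    obtain ⟨w', h1, h2, h3, h4, h5⟩ := hΔ j hj
    obtain ⟨n, hn⟩ : ∃ n : ℕ, (n : ℤ) = 1 + j := ⟨(1 + j).toNat, by omega⟩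
    obtain ⟨p1, p2, p3⟩ := tt_pow_ab a n
    refine ⟨List.replicate n a ++ w', ?_, ?_, ?_, ?_, ?_⟩
    · intro b hb
      simp at hb ⊢
      rcases hb with hb | hb
      · exact Or.inl hb.2
      · exact Or.inr (h1 b hb)
    · simp [h2, hn]; ring
    · simp [h3, p1, hn]; ring
    · simp [h4, p2, hn]; ring
    · simp only [List.prod_append, List.prod_replicate, List.prod_cons, tt_mul, h5, p3, W_cons]
      simp only [wedge, h3, h4, p1, p2, hn]; ring

/-- The open half-plane (with one boundary ray). -/
def Half (g : Heis) : Prop := 0 < g.b ∨ (g.b = 0 ∧ 0 < g.a)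

lemma half_or {g : Heis} (h : ¬ (g.a = 0 ∧ g.b = 0)) : Half g ∨ Half g⁻¹ := by
  simp only [Half, Heis.inv_a, Heis.inv_b]
  omega

lemma wedge_trans {g h k : Heis} (hg : Half g) (hh : Half h) (hk : Half k)
    (h1 : 0 ≤ wedge g h) (h2 : 0 ≤ wedge h k) : 0 ≤ wedge g k := by
  unfold wedge at *
  rcases hh with hh | ⟨hh, hh'⟩
  · have hgb : 0 ≤ g.b := by rcases hg with h | h <;> omega
    have hkb : 0 ≤ k.b := by rcases hk with h | h <;> omega
    have key : h.b * (g.a * k.b - g.b * k.a) =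
      k.b * (g.a * h.b - g.b * h.a) + g.b * (h.a * k.b - h.b * k.a) := by ring
    have : 0 ≤ h.b * (g.a * k.b - g.b * k.a) := by rw [key]; positivity
    exact nonneg_of_mul_nonneg_right this hh
  · have hkb : 0 ≤ k.b := by rcases hk with h | h <;> omega
    rw [hh] at h1
    rcases hg with hg | ⟨hg, hg'⟩
    · nlinarith
    · rw [hg]; nlinarith

open Classical in
/-- The quadratic form of the zonogon area. -/
noncomputable def Z (S : Finset Heis) (x : S → ℝ) : ℝ :=
  (∑ g : S, ∑ h : S, x g * x h * |(wedge g h : ℝ)|) / 2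

lemma abs_wedge_swap (g h : Heis) : |(wedge g h : ℝ)| = |(wedge h g : ℝ)| := by
  rw [wedge_swap g h]; push_cast; rw [abs_neg]

lemma Z_add (S : Finset Heis) (x y : S → ℝ) :
    Z S (x + y) = Z S x + Z S y + ∑ g : S, ∑ h : S, x g * y h * |(wedge g h : ℝ)| := by
  have h1 : ∑ g : S, ∑ h : S, y g * x h * |(wedge g h : ℝ)| =
      ∑ g : S, ∑ h : S, x g * y h * |(wedge g h : ℝ)| := by
    rw [Finset.sum_comm]
    refine Finset.sum_congr rfl fun g _ => Finset.sum_congr rfl fun h _ => ?_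
    rw [abs_wedge_swap]; ring
  have h2 : ∑ g : S, ∑ h : S, (x + y) g * (x + y) h * |(wedge g h : ℝ)| =
      ∑ g : S, ∑ h : S, x g * x h * |(wedge g h : ℝ)| +
      ∑ g : S, ∑ h : S, y g * y h * |(wedge g h : ℝ)| +
      ∑ g : S, ∑ h : S, x g * y h * |(wedge g h : ℝ)| +
      ∑ g : S, ∑ h : S, y g * x h * |(wedge g h : ℝ)| := by
    simp only [← Finset.sum_add_distrib]
    refine Finset.sum_congr rfl fun g _ => Finset.sum_congr rfl fun h _ => ?_
    simp only [Pi.add_apply]; ring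
  unfold Z
  rw [h2, h1]; ring

lemma Z_smul (S : Finset Heis) (c : ℝ) (x : S → ℝ) : Z S (c • x) = c ^ 2 * Z S x := by
  unfold Z
  rw [mul_div_assoc', Finset.mul_sum]
  congr 1
  refine Finset.sum_congr rfl fun g _ => ?_
  rw [Finset.mul_sum]
  refine Finset.sum_congr rfl fun h _ => ?_
  simp only [Pi.smul_apply, smul_eq_mul]; ring

open Classical in
/-- Multiplicity vector of a list. -/
noncomputable def cnt {S : Finset Heis} (u : List S) : S → ℝ := fun g => (u.count g : ℝ)

open Classical in
lemma cnt_cons {S : Finset Heis} (g : S) (u : List S) : cnt (g :: u) = cnt u + Pi.single g 1 := by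
  funext h
  simp only [cnt, List.count_cons, Pi.add_apply, Pi.single_apply]
  by_cases e : h = g
  · subst e; simp
  · simp [e, Ne.symm e]

lemma Z_cnt_cons {S : Finset Heis} (g : S) (u : List S) :
    Z S (cnt (g :: u)) = Z S (cnt u) + ∑ h : S, cnt u h * |(wedge g h : ℝ)| := by
  classical
  rw [cnt_cons, Z_add]
  have h1 : Z S (Pi.single g (1 : ℝ)) = 0 := by
    unfold Z
    have : ∀ a : S, ∑ b : S, (Pi.single g (1 : ℝ) : S → ℝ) a * (Pi.single g (1 : ℝ) : S → ℝ) b *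
        |(wedge a b : ℝ)| = 0 := by
      intro a
      refine Finset.sum_eq_zero fun b _ => ?_
      by_cases ha : a = g
      · by_cases hb : b = g
        · subst ha; subst hb; simp [wedge_self]
        · simp [Pi.single_apply, hb]
      · simp [Pi.single_apply, ha]
    rw [Finset.sum_eq_zero (fun a _ => this a), zero_div]
  have h2 : ∑ a : S, ∑ b : S, cnt u a * (Pi.single g (1 : ℝ) : S → ℝ) b * |(wedge a b : ℝ)| =
      ∑ h : S, cnt u h * |(wedge g h : ℝ)| := by
    refine Finset.sum_congr rfl fun a _ => ?_
    rw [Finset.sum_eq_single g]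
    · simp [abs_wedge_swap]
    · intro b _ hb; simp [hb]
    · simp
  rw [h1, h2]; ring

lemma cnt_sum {S : Finset Heis} (u : List S) : ∑ g : S, cnt u g = u.length := by
  classical
  induction u with
  | nil => simp [cnt]
  | cons g u ih =>
    rw [cnt_cons]
    simp only [Pi.add_apply, Finset.sum_add_distrib, ih, Finset.sum_pi_single', Finset.mem_univ,
      if_true, List.length_cons]
    push_cast; ring

lemma Z_cnt_nil {S : Finset Heis} : Z S (cnt []) = 0 := by simp [Z, cnt]

/-- For sorted lists `W` is the zonogon form. -/
lemma W_sorted {S : Finset Heis} (u : List S) (hu : u.Pairwise (fun g h : S => 0 ≤ wedge g h)) :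
    (W (u.map Subtype.val) : ℝ) = Z S (cnt u) := by
  classical
  induction u with
  | nil => simp [Z_cnt_nil]
  | cons g u ih =>
    rw [List.pairwise_cons] at hu
    rw [Z_cnt_cons, ← ih hu.2, List.map_cons, W_cons]
    have : ∀ v : List S, (∀ h ∈ v, 0 ≤ wedge g h) →
        (wedge g (v.map Subtype.val).prod : ℝ) = ∑ h : S, cnt v h * |(wedge g h : ℝ)| := by
      intro v
      induction v with
      | nil => intro _; simp [cnt]
      | cons k v ihv =>
        intro hv
        rw [List.map_cons, List.prod_cons, wedge_mul_right, cnt_cons]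
        push_cast
        rw [ihv (fun h hh => hv h (by simp [hh]))]
        have h0 : (0 : ℝ) ≤ wedge g k := by exact_mod_cast hv k (by simp)
        simp only [Pi.add_apply, add_mul, Finset.sum_add_distrib]
        rw [Finset.sum_eq_single (a := k) (f := fun h : S => (Pi.single k (1 : ℝ) : S → ℝ) h * _)]
        · simp only [Pi.single_eq_same, one_mul, abs_of_nonneg h0]; ring
        · intro b _ hb; simp [hb]
        · simp
    push_cast
    rw [this u hu.1]; ring

/-- General upper bound for `W` via the zonogon form. -/
lemma W_le_Z {S : Finset Heis} (w : List Heis)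
    (hw : ∀ a ∈ w, (a.a = 0 ∧ a.b = 0) ∨ a ∈ S ∨ a⁻¹ ∈ S) :
    ∃ u : List S, u.length ≤ w.length ∧ |(W w : ℝ)| ≤ Z S (cnt u) ∧
      ∀ k : Heis, |(wedge k w.prod : ℝ)| ≤ ∑ h : S, cnt u h * |(wedge k h : ℝ)| := by
  classical
  induction w with
  | nil => exact ⟨[], by simp [Z_cnt_nil, cnt]⟩
  | cons a w ih =>
    obtain ⟨u, h1, h2, h3⟩ := ih (fun b hb => hw b (by simp [hb]))
    by_cases h0 : a.a = 0 ∧ a.b = 0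
    · refine ⟨u, by simp; omega, ?_, ?_⟩
      · have : wedge a w.prod = 0 := by simp [wedge, h0.1, h0.2]
        simpa [this] using h2
      · intro k
        have : wedge k a = 0 := by simp [wedge, h0.1, h0.2]
        rw [List.prod_cons, wedge_mul_right, this, zero_add]
        exact h3 k
    · obtain ⟨g, hg⟩ : ∃ g : S, ∀ k : Heis, |(wedge a k : ℝ)| = |(wedge g k : ℝ)| := by
        rcases hw a (by simp) with h | h | h
        · exact absurd h h0
        · exact ⟨⟨a, h⟩, fun k => rfl⟩
        · refine ⟨⟨a⁻¹, h⟩, fun k => ?_⟩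
          rw [wedge_inv_left]; push_cast; rw [abs_neg]
      refine ⟨g :: u, by simp; omega, ?_, ?_⟩
      · rw [Z_cnt_cons, W_cons]
        push_cast
        refine (abs_add_le _ _).trans ?_
        have h4 := h3 g
        rw [hg]
        linarith
      · intro k
        rw [List.prod_cons, wedge_mul_right, cnt_cons]
        push_cast
        refine (abs_add_le _ _).trans ?_
        have h4 := h3 k
        simp only [Pi.add_apply, add_mul, Finset.sum_add_distrib]
        rw [Finset.sum_eq_single (a := g) (f := fun h : S => (Pi.single g (1 : ℝ) : S → ℝ) h * _)]
        · rw [abs_wedge_swap k a, hg, abs_wedge_swap]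
          simp only [Pi.single_eq_same, one_mul]; linarith
        · intro b _ hb; simp [hb]
        · simp

lemma exists_max_Z (S : Finset Heis) (hS : S.Nonempty) :
    ∃ s : S → ℝ, s ∈ stdSimplex ℝ S ∧ ∀ x : S → ℝ, (∀ g, 0 ≤ x g) →
      Z S x ≤ Z S s * (∑ g, x g) ^ 2 := by
  classical
  obtain ⟨g0, hg0⟩ := hS
  have hne : (stdSimplex ℝ S).Nonempty := ⟨_, single_mem_stdSimplex ℝ (⟨g0, hg0⟩ : S)⟩
  have hcont : Continuous (Z S) := by unfold Z; fun_prop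
  obtain ⟨s, hs, hmax⟩ := (isCompact_stdSimplex ℝ S).exists_isMaxOn hne hcont.continuousOn
  refine ⟨s, hs, fun x hx => ?_⟩
  by_cases h0 : ∑ g, x g = 0
  · have : ∀ g, x g = 0 := by
      intro g
      exact (Finset.sum_eq_zero_iff_of_nonneg (fun g _ => hx g)).1 h0 g (Finset.mem_univ g)
    have hz : Z S x = 0 := by simp [Z, this]
    rw [hz, h0]; simp
  · set c := ∑ g, x g with hc
    have hcpos : 0 < c := lt_of_le_of_ne (Finset.sum_nonneg fun g _ => hx g) (Ne.symm h0)
    have hmem : c⁻¹ • x ∈ stdSimplex ℝ S := by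
      refine ⟨fun g => ?_, ?_⟩
      · simp only [Pi.smul_apply, smul_eq_mul]
        exact mul_nonneg (by positivity) (hx g)
      · simp only [Pi.smul_apply, smul_eq_mul, ← Finset.mul_sum, ← hc]
        exact inv_mul_cancel₀ h0
    have h1 : Z S (c⁻¹ • x) ≤ Z S s := hmax hmem
    rw [Z_smul] at h1
    have h2 : Z S x = c ^ 2 * ((c⁻¹) ^ 2 * Z S x) := by field_simp
    rw [h2, mul_comm (Z S s)]
    exact mul_le_mul_of_nonneg_left h1 (by positivity)

lemma orderedInsert_split {α : Type*} (r : α → α → Prop) [DecidableRel r] (a : α) (l : List α) :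
    ∃ x y, l = x ++ y ∧ l.orderedInsert r a = x ++ a :: y := by
  refine ⟨_, _, ?_, List.orderedInsert_eq_take_drop r a l⟩
  rw [List.takeWhile_append_dropWhile]

lemma exists_nested (S : Finset Heis) (hS : ∀ g ∈ S, Half g) (s : S → ℝ)
    (hs : s ∈ stdSimplex ℝ S) :
    ∃ F : ℝ, 0 ≤ F ∧ ∃ u : ℕ → List S, (∀ n, (u n).length = n) ∧
      (∀ n, (u n).Pairwise (fun g h : S => 0 ≤ wedge g h)) ∧
      (∀ n, ∃ g x y, u n = x ++ y ∧ u (n + 1) = x ++ g :: y) ∧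
      ∀ n : ℕ, Z S s * n ^ 2 - F * n ≤ Z S (cnt (u n)) := by
  classical
  let r : S → S → Prop := fun g h => 0 ≤ wedge g h
  have : Std.Total r := ⟨fun g h => by
    change 0 ≤ wedge g h ∨ 0 ≤ wedge h g
    rw [wedge_swap h g]; omega⟩
  have : IsTrans S r := ⟨fun g h k h1 h2 =>
    wedge_trans (hS _ g.2) (hS _ h.2) (hS _ k.2) h1 h2⟩
  have step : ∀ (n : ℕ) (u : List S), ∃ g : S, u.length = n → cnt u g < (n + 1) * s g := by
    intro n u
    by_cases hl : u.length = n
    · by_contra! hcon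
      have h1 : ∑ g, ((n : ℝ) + 1) * s g ≤ ∑ g, cnt u g :=
        Finset.sum_le_sum fun g _ => (hcon g).2
      rw [← Finset.mul_sum, hs.2, cnt_sum, hl] at h1
      linarith
    · have : Nonempty S := by
        by_contra hne
        rw [not_nonempty_iff] at hne
        have := hs.2
        simp at this
      exact ⟨this.some, fun h => absurd h hl⟩
  choose pick hpick using step
  let u : ℕ → List S := fun n => Nat.rec [] (fun n v => v.orderedInsert r (pick n v)) n
  have u0 : u 0 = [] := rfl
  have us : ∀ n, u (n + 1) = (u n).orderedInsert r (pick n (u n)) := fun n => rfl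
  have hlen : ∀ n, (u n).length = n := by
    intro n
    induction n with
    | zero => rfl
    | succ n ih => rw [us, List.orderedInsert_length, ih]
  have hsort : ∀ n, (u n).Pairwise r := by
    intro n
    induction n with
    | zero => rw [u0]; exact List.Pairwise.nil
    | succ n ih => rw [us]; exact List.Pairwise.orderedInsert _ _ ih
  have hcnt : ∀ n, cnt (u (n + 1)) = cnt (u n) + Pi.single (pick n (u n)) 1 := by
    intro n
    rw [← cnt_cons, us]
    funext g
    simp only [cnt]
    rw [(List.perm_orderedInsert r (pick n (u n)) (u n)).count_eq]
  have hub : ∀ n g, cnt (u n) g ≤ n * s g + 1 := by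
    intro n
    induction n with
    | zero => intro g; simp [u0, cnt]
    | succ n ih =>
      intro g
      rw [hcnt]
      push_cast
      by_cases hg : g = pick n (u n)
      · have := hpick n (u n) (hlen n)
        rw [← hg] at this ⊢
        simp only [Pi.add_apply, Pi.single_eq_same]
        linarith
      · simp only [Pi.add_apply, Pi.single_eq_of_ne hg]
        have := ih g
        have := hs.1 g
        linarith
  set R : ℝ := ((Fintype.card S : ℕ) : ℝ) with hR
  have hδ : ∀ n g, |cnt (u n) g - n * s g| ≤ R + 1 := by
    intro n g
    have hRn : 0 ≤ R := by positivity
    rw [abs_le]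
    constructor
    · have hsum : ∑ h, (1 - (cnt (u n) h - n * s h)) = R := by
        rw [Finset.sum_sub_distrib, Finset.sum_sub_distrib, ← Finset.mul_sum, hs.2, cnt_sum, hlen]
        simp [hR]
      have := Finset.single_le_sum (f := fun h => (1 - (cnt (u n) h - n * s h)))
        (fun h _ => by have := hub n h; linarith) (Finset.mem_univ g)
      rw [hsum] at this
      have h3 : (R:ℝ) = R := rfl
      linarith
    · have := hub n g; linarith
  set Cc : ℝ := ∑ g : S, ∑ h : S, |(wedge g h : ℝ)| with hCc
  have hCc0 : 0 ≤ Cc := Finset.sum_nonneg fun g _ => Finset.sum_nonneg fun h _ => abs_nonneg _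
  have hs1 : ∀ g, s g ≤ 1 := by
    intro g
    have := Finset.single_le_sum (f := s) (fun h _ => hs.1 h) (Finset.mem_univ g)
    rwa [hs.2] at this
  have hR0 : 0 ≤ R := by positivity
  refine ⟨(R + 1) * Cc + (R + 1) ^ 2 * Cc, by positivity, u, hlen, hsort, ?_, ?_⟩
  · intro n
    obtain ⟨x, y, h1, h2⟩ := orderedInsert_split r (pick n (u n)) (u n)
    exact ⟨_, x, y, h1, by rw [us, h2]⟩
  · intro n
    rcases Nat.eq_zero_or_pos n with rfl | hn
    · simp [u0, Z_cnt_nil]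
    have hn1 : (1 : ℝ) ≤ n := by exact_mod_cast hn
    set d : S → ℝ := fun g => cnt (u n) g - n * s g with hd
    have e : cnt (u n) = (n : ℝ) • s + d := by
      funext g; simp [hd]
    have b1 : -((R + 1) ^ 2 * Cc) ≤ Z S d := by
      have : -(∑ g : S, ∑ h : S, (R + 1) ^ 2 * |(wedge g h : ℝ)|) ≤
          ∑ g : S, ∑ h : S, d g * d h * |(wedge g h : ℝ)| := by
        rw [← Finset.sum_neg_distrib]
        refine Finset.sum_le_sum fun g _ => ?_
        rw [← Finset.sum_neg_distrib]
        refine Finset.sum_le_sum fun h _ => ?_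
        have h1 : |d g * d h| ≤ (R + 1) ^ 2 := by
          rw [abs_mul, sq]
          exact mul_le_mul (hδ n g) (hδ n h) (abs_nonneg _) (by positivity)
        have h2 := (abs_le.1 h1).1
        rw [← neg_mul]
        exact mul_le_mul_of_nonneg_right h2 (abs_nonneg _)
      simp only [← Finset.mul_sum] at this
      rw [← hCc] at this
      unfold Z
      have h0 : 0 ≤ (R + 1) ^ 2 * Cc := by positivity
      linarith
    have b2 : -(n * ((R + 1) * Cc)) ≤ ∑ g : S, ∑ h : S, ((n : ℝ) • s) g * d h * |(wedge g h : ℝ)| := by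
      have : -(∑ g : S, ∑ h : S, (n * (R + 1)) * |(wedge g h : ℝ)|) ≤
          ∑ g : S, ∑ h : S, ((n : ℝ) • s) g * d h * |(wedge g h : ℝ)| := by
        rw [← Finset.sum_neg_distrib]
        refine Finset.sum_le_sum fun g _ => ?_
        rw [← Finset.sum_neg_distrib]
        refine Finset.sum_le_sum fun h _ => ?_
        have h1 : |((n : ℝ) • s) g * d h| ≤ n * (R + 1) := by
          rw [abs_mul]
          refine mul_le_mul ?_ (hδ n h) (abs_nonneg _) (by positivity)
          simp only [Pi.smul_apply, smul_eq_mul]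
          rw [abs_of_nonneg (mul_nonneg (by positivity) (hs.1 g))]
          have := hs1 g
          nlinarith
        have h2 := (abs_le.1 h1).1
        rw [← neg_mul]
        exact mul_le_mul_of_nonneg_right h2 (abs_nonneg _)
      simp only [← Finset.mul_sum] at this
      rw [← hCc] at this
      linarith
    rw [e, Z_add, Z_smul]
    have h3 : (R + 1) ^ 2 * Cc ≤ (R + 1) ^ 2 * Cc * n := by
      have : 0 ≤ (R + 1) ^ 2 * Cc := by positivity
      nlinarith
    nlinarith

lemma exists_wedge_ne (A : Finset Heis) (hA : IsGenSet A) :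
    ∃ g ∈ A, ∃ h ∈ A, wedge g h ≠ 0 := by
  by_contra! hcon
  have hcomm : ∀ g ∈ A, ∀ h ∈ A, g * h = h * g := by
    intro g hg h hh
    have := hcon g hg h hh
    unfold wedge at this
    ext
    · simp; ring
    · simp; ring
    · simp; linarith
  have h1 : ∀ g : Heis, ∀ h ∈ A, g * h = h * g := by
    intro g h hh
    have hg : g ∈ Subgroup.closure (A : Set Heis) := by rw [hA]; trivial
    have hle : Subgroup.closure (A : Set Heis) ≤ Subgroup.centralizer {h} := by
      rw [Subgroup.closure_le]
      intro k hk
      rw [SetLike.mem_coe, Subgroup.mem_centralizer_singleton_iff]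
      exact hcomm k hk h hh
    have := hle hg
    rw [Subgroup.mem_centralizer_singleton_iff] at this
    first | exact this | exact this.symm
  have h2 : ∀ g h : Heis, g * h = h * g := by
    intro g h
    have hg : h ∈ Subgroup.closure (A : Set Heis) := by rw [hA]; trivial
    have hle : Subgroup.closure (A : Set Heis) ≤ Subgroup.centralizer {g} := by
      rw [Subgroup.closure_le]
      intro k hk
      rw [SetLike.mem_coe, Subgroup.mem_centralizer_singleton_iff]
      first | exact h1 g k hk | exact (h1 g k hk).symm
    have := hle hg
    rw [Subgroup.mem_centralizer_singleton_iff] at this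
    first | exact this | exact this.symm
  have := congrArg Heis.c (h2 Heis.x Heis.y)
  simp [Heis.x, Heis.y] at this

lemma main_E (A : Finset Heis) (hA : IsGenSet A) :
    ∃ E F T : ℝ, 0 < E ∧ 0 ≤ F ∧ 0 ≤ T ∧
      (∀ w, IsWordOn A w → (W w : ℝ) ≤ E * w.length ^ 2 ∧ -(W w : ℝ) ≤ E * w.length ^ 2) ∧
      (∀ w, IsWordOn A w → |(((w.map tt).sum : ℤ) : ℝ)| ≤ T * w.length) ∧
      ∃ u : ℕ → List Heis, (∀ n, IsWordOn A (u n)) ∧ (∀ n, (u n).length = n) ∧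
        (∀ n, ∃ g x y, (g ∈ A ∨ g⁻¹ ∈ A) ∧ u n = x ++ y ∧ u (n + 1) = x ++ g :: y) ∧
        ∀ n : ℕ, E * n ^ 2 - F * n ≤ (W (u n) : ℝ) := by
  classical
  obtain ⟨g1, hg1, g2, hg2, hne⟩ := exists_wedge_ne A hA
  let S : Finset Heis := (A ∪ A.image (·⁻¹)).filter Half
  have hSmem : ∀ g, g ∈ S ↔ (g ∈ A ∨ g⁻¹ ∈ A) ∧ Half g := by
    intro g
    simp only [S, Finset.mem_filter, Finset.mem_union, Finset.mem_image]
    constructor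
    · rintro ⟨h | ⟨k, hk, rfl⟩, h2⟩
      · exact ⟨Or.inl h, h2⟩
      · exact ⟨Or.inr (by simpa using hk), h2⟩
    · rintro ⟨h | h, h2⟩
      · exact ⟨Or.inl h, h2⟩
      · exact ⟨Or.inr ⟨_, h, by simp⟩, h2⟩
  have hlet : ∀ a, (a ∈ A ∨ a⁻¹ ∈ A) → (a.a = 0 ∧ a.b = 0) ∨ a ∈ S ∨ a⁻¹ ∈ S := by
    intro a ha
    by_cases h0 : a.a = 0 ∧ a.b = 0
    · exact Or.inl h0
    · right
      rcases half_or h0 with h | h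
      · exact Or.inl ((hSmem a).2 ⟨ha, h⟩)
      · exact Or.inr ((hSmem _).2 ⟨by rw [inv_inv]; exact ha.symm, h⟩)
  have hSne : S.Nonempty := by
    rcases hlet g1 (Or.inl hg1) with h | h | h
    · exact absurd (by simp [wedge, h.1, h.2]) hne
    · exact ⟨_, h⟩
    · exact ⟨_, h⟩
  obtain ⟨s, hs, hmax⟩ := exists_max_Z S hSne
  obtain ⟨F, hF, u, hu1, hu2, hu3, hu4⟩ := exists_nested S (fun g hg => ((hSmem g).1 hg).2) s hs
  have hZ0 : 0 ≤ Z S s := by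
    unfold Z
    refine div_nonneg (Finset.sum_nonneg fun g _ => Finset.sum_nonneg fun h _ => ?_) (by norm_num)
    exact mul_nonneg (mul_nonneg (hs.1 g) (hs.1 h)) (abs_nonneg _)
  have hW : ∀ w, IsWordOn A w → |(W w : ℝ)| ≤ Z S s * w.length ^ 2 := by
    intro w hw
    obtain ⟨v, hv1, hv2, -⟩ := W_le_Z (S := S) w (fun a ha => hlet a (hw a ha))
    have h1 := hmax (cnt v) (fun g => by simp [cnt])
    rw [cnt_sum] at h1
    have h2 : (v.length : ℝ) ^ 2 ≤ (w.length : ℝ) ^ 2 := by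
      have : (v.length : ℝ) ≤ w.length := by exact_mod_cast hv1
      gcongr
    exact hv2.trans (h1.trans (mul_le_mul_of_nonneg_left h2 hZ0))
  have hEpos : 0 < Z S s := by
    have h1 := hW [g1, g2] (by intro a ha; simp at ha; rcases ha with rfl | rfl <;> simp [*])
    simp at h1
    have h2 : 0 < |(wedge g1 g2 : ℝ)| := abs_pos.2 (by exact_mod_cast hne)
    by_contra hcon
    have : Z S s = 0 := le_antisymm (not_lt.1 hcon) hZ0
    rw [this] at h1
    linarith
  let T : ℝ := ∑ a ∈ A, |(tt a : ℝ)|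
  have hT0 : 0 ≤ T := Finset.sum_nonneg fun a _ => abs_nonneg _
  have hTl : ∀ a, (a ∈ A ∨ a⁻¹ ∈ A) → |(tt a : ℝ)| ≤ T := by
    intro a ha
    rcases ha with h | h
    · exact Finset.single_le_sum (f := fun a => |(tt a : ℝ)|) (fun a _ => abs_nonneg _) h
    · have := Finset.single_le_sum (f := fun a => |(tt a : ℝ)|) (fun a _ => abs_nonneg _) h
      simp only [tt_inv] at this
      push_cast at this
      rwa [abs_neg] at this
  refine ⟨Z S s, F, T, hEpos, hF, hT0, fun w hw => ?_, ?_, fun n => (u n).map Subtype.val,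
    ?_, ?_, ?_, ?_⟩
  · have := abs_le.1 (hW w hw)
    exact ⟨this.2, by linarith [this.1]⟩
  · intro w
    induction w with
    | nil => intro _; simp
    | cons a w ih =>
      intro hw
      have h1 := ih (fun b hb => hw b (by simp [hb]))
      have h2 := hTl a (hw a (by simp))
      simp only [List.map_cons, List.sum_cons, List.length_cons]
      push_cast
      refine (abs_add_le _ _).trans ?_
      push_cast at h1
      linarith
  · intro n a ha
    simp only [List.mem_map] at ha
    obtain ⟨b, -, rfl⟩ := ha
    exact ((hSmem _).1 b.2).1
  · intro n; simp [hu1]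
  · intro n
    obtain ⟨g, x, y, h1, h2⟩ := hu3 n
    exact ⟨g, x.map Subtype.val, y.map Subtype.val, ((hSmem _).1 g.2).1, by simp [h1], by simp [h2]⟩
  · intro n
    rw [W_sorted _ (hu2 n)]
    exact hu4 n

/-- The numerical facts about words on `A` used below. -/
structure Ctx (A : Finset Heis) (E T : ℝ) : Prop where
  E_pos : 0 < E
  T_nn : 0 ≤ T
  up : ∀ w, IsWordOn A w → (W w : ℝ) ≤ E * w.length ^ 2 ∧ -(W w : ℝ) ≤ E * w.length ^ 2
  tau : ∀ w, IsWordOn A w → |(((w.map tt).sum : ℤ) : ℝ)| ≤ T * w.length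

lemma word_append {A : Finset Heis} {u v : List Heis} :
    IsWordOn A (u ++ v) ↔ IsWordOn A u ∧ IsWordOn A v := by
  simp only [IsWordOn, List.mem_append]
  constructor
  · intro h; exact ⟨fun a ha => h a (Or.inl ha), fun a ha => h a (Or.inr ha)⟩
  · rintro ⟨h1, h2⟩ a (ha | ha)
    · exact h1 a ha
    · exact h2 a ha

lemma tt_W {A : Finset Heis} {E T : ℝ} (c : Ctx A E T) {w : List Heis} (hw : IsWordOn A w) :
    (tt w.prod : ℝ) ≤ W w + T * w.length ∧ (W w : ℝ) - T * w.length ≤ tt w.prod := by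
  have h := abs_le.1 (c.tau w hw)
  have e : (tt w.prod : ℝ) = ((w.map tt).sum : ℤ) + W w := by
    rw [tt_prod]; push_cast; rfl
  rw [e]
  constructor <;> linarith [h.1, h.2]

lemma W_closed_split {A : Finset Heis} {E T : ℝ} (c : Ctx A E T) {w : List Heis}
    (hw : IsWordOn A w) (hc : Closed w) (p q : ℕ) (hpq : w.length = p + q) :
    (W w : ℝ) ≤ E * p ^ 2 + E * q ^ 2 := by
  have e : w.take p ++ w.drop p = w := List.take_append_drop p w
  rw [← e] at hw hc
  rw [word_append] at hw
  have h := W_split hc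
  rw [e] at h
  rw [h]
  push_cast
  have h1 := (c.up _ hw.1).1
  have h2 := (c.up _ hw.2).1
  have l1 : (w.take p).length = p := by rw [List.length_take]; omega
  have l2 : (w.drop p).length = q := by rw [List.length_drop]; omega
  rw [l1] at h1
  rw [l2] at h2
  linarith

lemma W_closed {A : Finset Heis} {E T : ℝ} (c : Ctx A E T) {w : List Heis}
    (hw : IsWordOn A w) (hc : Closed w) :
    (W w : ℝ) ≤ E * (w.length ^ 2 + 1) / 2 := by
  have hE := c.E_pos
  rcases Nat.even_or_odd' w.length with ⟨k, hk | hk⟩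
  · have := W_closed_split c hw hc k k (by omega)
    rw [hk]; push_cast; nlinarith
  · have := W_closed_split c hw hc k (k + 1) (by omega)
    rw [hk]; push_cast at this ⊢; nlinarith

lemma tt_closed {A : Finset Heis} {E T : ℝ} (c : Ctx A E T) {w : List Heis}
    (hw : IsWordOn A w) (hc : Closed w) :
    (tt w.prod : ℝ) ≤ E * (w.length ^ 2 + 1) / 2 + T * w.length := by
  have := W_closed c hw hc
  have := (tt_W c hw).1
  linarith

lemma wedge_prod_le (al : List Heis) (b : Heis) (x : ℝ) (h : ∀ g ∈ al, (wedge g b : ℝ) ≤ x) :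
    (wedge al.prod b : ℝ) ≤ al.length * x := by
  induction al with
  | nil => simp
  | cons a al ih =>
    have h1 := ih (fun g hg => h g (by simp [hg]))
    have h2 := h a (by simp)
    rw [List.prod_cons, wedge_mul_left]
    push_cast [List.length_cons]
    linarith

lemma gain_one {A : Finset Heis} {E T : ℝ} (c : Ctx A E T) (C ε : ℝ) (hC : 0 ≤ C) (hε : 0 < ε) :
    ∃ L0 : ℕ, ∀ w, IsWordOn A w → Closed w → L0 ≤ w.length →
      E * w.length ^ 2 / 2 - C * w.length ≤ tt w.prod →
      ∃ w', IsWordOn A w' ∧ Closed w' ∧ w'.length = w.length + 2 ∧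
        (tt w.prod : ℝ) + 2 * (E - ε) * w.length ≤ tt w'.prod := by
  have hE := c.E_pos
  have hT := c.T_nn
  obtain ⟨J, hJ⟩ := exists_nat_ge ((C + T + E / 2 + 1) / ε)
  rw [div_le_iff₀ hε] at hJ
  have hJpos : 0 < J := by
    rcases Nat.eq_zero_or_pos J with h | h
    · rw [h] at hJ; push_cast at hJ; linarith
    · exact h
  obtain ⟨N, hN⟩ := exists_nat_gt (E / 4 + 2 * E * J ^ 2)
  refine ⟨N + 2 * J, fun w hw hc hL hlow => ?_⟩
  set h := w.length / 2 with hh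
  have hJh : J ≤ h := by omega
  set al := w.take J with hal
  set be := (w.drop J).take (h - J) with hbe
  set v := (w.drop J).drop (h - J) with hv
  have e : al ++ be ++ v = w := by
    rw [List.append_assoc, hbe, hv, List.take_append_drop, hal, List.take_append_drop]
  have l1 : al.length = J := by rw [hal, List.length_take]; omega
  have l2 : be.length = h - J := by rw [hbe, List.length_take, List.length_drop]; omega
  have l3 : v.length = w.length - h := by
    rw [hv, List.length_drop, List.length_drop]; omega
  have hw' := hw
  have hc' := hc
  rw [← e] at hw' hc'
  have hWs := W_split hc'
  rw [W_append al be, e] at hWs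
  rw [word_append, word_append] at hw'
  have b1 := (c.up _ hw'.1.1).1
  have b2 := (c.up _ hw'.1.2).1
  have b3 := (c.up _ hw'.2).1
  have b4 := (tt_W c hw).1
  rw [l1] at b1
  rw [l2] at b2
  rw [l3] at b3
  have hWs' : (W w : ℝ) = W al + W be + wedge al.prod be.prod + W v := by exact_mod_cast hWs
  set L : ℝ := (w.length : ℝ) with hLdef
  have r2 : (((h - J : ℕ) : ℝ)) ≤ L / 2 - J := by
    rw [Nat.cast_sub hJh]
    have : (h : ℝ) * 2 ≤ L := by rw [hLdef]; exact_mod_cast (by omega : h * 2 ≤ w.length)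
    linarith
  have r3 : (((w.length - h : ℕ) : ℝ)) ≤ (L + 1) / 2 := by
    have : ((w.length - h : ℕ) : ℝ) * 2 ≤ L + 1 := by
      rw [hLdef]; exact_mod_cast (by omega : (w.length - h) * 2 ≤ w.length + 1)
    linarith
  have r2' : (((h - J : ℕ) : ℝ)) ^ 2 ≤ (L / 2 - J) ^ 2 := by gcongr
  have r3' : (((w.length - h : ℕ) : ℝ)) ^ 2 ≤ ((L + 1) / 2) ^ 2 := by gcongr
  have b2' := b2.trans (mul_le_mul_of_nonneg_left r2' hE.le)
  have b3' := b3.trans (mul_le_mul_of_nonneg_left r3' hE.le)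
  have hLN : E / 4 + 2 * E * J ^ 2 < L := by
    have : (N : ℝ) ≤ L := by rw [hLdef]; exact_mod_cast (by omega : N ≤ w.length)
    linarith
  have hL0 : 0 ≤ L := by positivity
  obtain ⟨g, hg, hgain⟩ : ∃ g ∈ al, (E - ε) * L ≤ wedge g be.prod := by
    by_contra! hcon
    have h1 := wedge_prod_le al be.prod ((E - ε) * L) (fun g hg => (hcon g hg).le)
    rw [l1] at h1
    have h2 : (C + T + E / 2 + 1) * L ≤ J * ε * L := mul_le_mul_of_nonneg_right hJ hL0
    nlinarith
  have hp := insert_pair al be v g hc'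
  refine ⟨_, ?_, hp.1, ?_, ?_⟩
  · intro a ha
    have hgA := hw'.1.1 g hg
    simp only [List.mem_append, List.mem_cons] at ha
    rcases ha with ha | ha | ha | ha | ha
    · exact hw'.1.1 a ha
    · rw [ha]; exact hgA
    · exact hw'.1.2 a ha
    · rw [ha, inv_inv]; exact hgA.symm
    · exact hw'.2 a ha
  · have : w.length = (al ++ be ++ v).length := by rw [e]
    rw [this]; simp; omega
  · rw [hp.2, e]; push_cast; linarith

lemma gain_iter {A : Finset Heis} {E T : ℝ} (c : Ctx A E T) (C ε : ℝ) (hC : 0 ≤ C) (hε : 0 < ε)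
    (hεE : ε ≤ E) (q : ℕ) :
    ∃ L0 : ℕ, ∀ w, IsWordOn A w → Closed w → L0 ≤ w.length →
      E * w.length ^ 2 / 2 - C * w.length ≤ tt w.prod →
      ∃ w', IsWordOn A w' ∧ Closed w' ∧ w'.length = w.length + 2 * q ∧
        (tt w.prod : ℝ) + 2 * q * (E - ε) * w.length ≤ tt w'.prod := by
  have hE := c.E_pos
  induction q with
  | zero => exact ⟨0, fun w h1 h2 _ _ => ⟨w, h1, h2, by simp, by simp⟩⟩
  | succ q ih =>
    obtain ⟨L1, h1⟩ := ih
    obtain ⟨L2, h2⟩ := gain_one c (C + 2 * E * q) ε (by positivity) hε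
    refine ⟨max L1 L2, fun w hw hc hL hlow => ?_⟩
    obtain ⟨w1, a1, a2, a3, a4⟩ := h1 w hw hc (le_trans (le_max_left _ _) hL) hlow
    have hL0 : (0 : ℝ) ≤ w.length := by positivity
    have hg0 : 0 ≤ 2 * (q : ℝ) * (E - ε) * w.length := by
      have : 0 ≤ E - ε := by linarith
      positivity
    have hlen : (w1.length : ℝ) = w.length + 2 * q := by rw [a3]; push_cast; ring
    obtain ⟨w2, b1, b2, b3, b4⟩ := h2 w1 a1 a2
      (by have := le_trans (le_max_right L1 L2) hL; omega) (by
        rw [hlen]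
        have : 0 ≤ C * (q : ℝ) := by positivity
        have : 0 ≤ E * (q : ℝ) ^ 2 := by positivity
        nlinarith)
    refine ⟨w2, b1, b2, by omega, ?_⟩
    rw [hlen] at b4
    push_cast
    have : 0 ≤ (E - ε) * (q : ℝ) := mul_nonneg (by linarith) (by positivity)
    nlinarith

set_option maxHeartbeats 1000000 in
lemma improve {A : Finset Heis} {E T : ℝ} (c : Ctx A E T) (C : ℝ) (hC : 0 ≤ C) (d : ℕ) :
    ∃ N : ℕ, ∀ w, IsWordOn A w → Closed w → N ≤ w.length →
      E * w.length ^ 2 / 2 - C * w.length ≤ tt w.prod →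
      ∀ l : List Heis, l.Sublist w → Closed l → l.length = d →
      ∃ w', IsWordOn A w' ∧ Closed w' ∧ w'.length + d = w.length + 2 * (d / 2 + 1) ∧
        tt w.prod < tt w'.prod := by
  have hE := c.E_pos
  have hT := c.T_nn
  set q := d / 2 + 1 with hq
  have hqd : (d : ℝ) + 1 ≤ 2 * q := by exact_mod_cast (by omega : d + 1 ≤ 2 * q)
  set ε : ℝ := E / (2 * (2 * q + 1)) with hεdef
  have hε : 0 < ε := by positivity
  have hεq : (2 * q + 1) * ε = E / 2 := by rw [hεdef]; field_simp
  have hq0 : (0 : ℝ) ≤ q := by positivity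
  have hεE : ε ≤ E := by nlinarith
  obtain ⟨J, hJ⟩ := exists_nat_ge ((C + T + ε) / ε)
  rw [div_le_iff₀ hε] at hJ
  have hJ1 : (1 : ℝ) ≤ J := by
    have : 0 < J := by
      rcases Nat.eq_zero_or_pos J with h | h
      · rw [h] at hJ; push_cast at hJ; linarith
      · exact h
    exact_mod_cast this
  set cJ : ℝ := E * (J ^ 2 * d ^ 2 + 1) / 2 + T * (J * d) + J ^ 2 * (E * d ^ 2) with hcJ
  have hcJ0 : 0 ≤ cJ := by positivity
  obtain ⟨L0, hL0⟩ := gain_iter c (2 * (C + ε) + 1) ε (by positivity) hε hεE q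
  obtain ⟨N1, hN1⟩ := exists_nat_gt (2 * (cJ + E * d ^ 2 + E * d ^ 2 / 2))
  obtain ⟨N2, hN2⟩ := exists_nat_gt ((2 * q * E * d + cJ + E * d ^ 2) / (E / 2))
  rw [div_lt_iff₀ (by positivity)] at hN2
  refine ⟨L0 + N1 + N2 + 2 * d, fun w hw hc hN hlow l hl hlc hld => ?_⟩
  obtain ⟨Δ, hΔ⟩ := sublist_quad hl
  have hlw : IsWordOn A l := fun a ha => hw a (hl.subset ha)
  have hWl := c.up l hlw
  rw [hld] at hWl
  have mN1 : (N1 : ℝ) ≤ w.length := by exact_mod_cast (by omega : N1 ≤ w.length)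
  have mN2 : (N2 : ℝ) ≤ w.length := by exact_mod_cast (by omega : N2 ≤ w.length)
  have m2d : 2 * (d : ℝ) ≤ w.length := by exact_mod_cast (by omega : 2 * d ≤ w.length)
  set m : ℝ := (w.length : ℝ) with hm
  -- upper bound on Δ
  have hΔup : (Δ : ℝ) ≤ E * m * d + ε * m + cJ := by
    obtain ⟨w1, a1, a2, a3, a4, a5⟩ := hΔ (J : ℤ) (by omega)
    have hc1 : Closed w1 := ⟨by rw [a3, hc.1, hlc.1]; ring, by rw [a4, hc.2, hlc.2]; ring⟩
    have h1 := tt_closed c (fun a ha => hw a (a1 a ha)) hc1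
    have e1 : (w1.length : ℝ) = m + J * d := by
      rw [hld] at a2; rw [hm]; exact_mod_cast a2
    have e2 : (tt w1.prod : ℝ) = tt w.prod + J * Δ + J ^ 2 * W l := by exact_mod_cast a5
    rw [e1, e2] at h1
    have h2 : (J : ℝ) ^ 2 * (-(W l : ℝ)) ≤ J ^ 2 * (E * d ^ 2) :=
      mul_le_mul_of_nonneg_left hWl.2 (by positivity)
    have hm0 : 0 ≤ m := by positivity
    have h3 : (C + T + ε) * m ≤ J * ε * m := mul_le_mul_of_nonneg_right hJ hm0
    have h4 : J * (Δ : ℝ) ≤ J * (E * m * d) + J * ε * m + cJ := by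
      linarith [mul_nonneg hε.le hm0, hcJ]
    have h5 : J * (Δ : ℝ) ≤ J * (E * m * d + ε * m + cJ) := by
      have h5' : 1 * cJ ≤ J * cJ := mul_le_mul_of_nonneg_right hJ1 hcJ0
      linarith
    exact le_of_mul_le_mul_left h5 (by linarith)
  obtain ⟨w1, a1, a2, a3, a4, a5⟩ := hΔ (-1) le_rfl
  have hc1 : Closed w1 := ⟨by rw [a3, hc.1, hlc.1]; ring, by rw [a4, hc.2, hlc.2]; ring⟩
  have hw1 : IsWordOn A w1 := fun a ha => hw a (a1 a ha)
  rw [hld] at a2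
  have e1 : (w1.length : ℝ) = m - d := by
    have : ((w1.length : ℤ) : ℝ) = ((w.length + -1 * d : ℤ) : ℝ) := by rw [a2]
    push_cast at this
    rw [hm]; linarith
  have e2 : (tt w1.prod : ℝ) = tt w.prod - Δ + W l := by
    rw [a5]; push_cast; ring
  have hlow1 : (tt w.prod : ℝ) - E * m * d - ε * m - cJ - E * d ^ 2 ≤ tt w1.prod := by
    rw [e2]; linarith [hWl.2]
  obtain ⟨w2, b1, b2, b3, b4⟩ := hL0 w1 hw1 hc1 (by omega) (by
    rw [e1]
    have hCε : 0 ≤ C + ε := by positivity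
    have h6 : (C + ε) * (2 * d) ≤ (C + ε) * m := mul_le_mul_of_nonneg_left m2d hCε
    linarith)
  refine ⟨w2, b1, b2, by omega, ?_⟩
  have hfin : (tt w.prod : ℝ) < tt w2.prod := by
    rw [e1] at b4
    have hm0 : 0 ≤ m := by positivity
    have h7 : (2 * q + 1) * ε * m = E / 2 * m := by rw [hεq]
    have h8 : ((d : ℝ) + 1) * (E * m) ≤ 2 * q * (E * m) :=
      mul_le_mul_of_nonneg_right hqd (by positivity)
    have h9 : 0 ≤ 2 * (q : ℝ) * ε * d := by positivity
    have h10 : E / 2 * N2 ≤ E / 2 * m := mul_le_mul_of_nonneg_left mN2 (by positivity)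
    linarith
  exact_mod_cast hfin

lemma odd_sublist (A : Finset Heis) :
    ∃ K : ℕ, ∀ w, IsWordOn A w → Closed w → Odd w.length →
      ∃ l : List Heis, l.Sublist w ∧ Closed l ∧ Odd l.length ∧ l.length ≤ K := by
  classical
  by_contra! hcon
  choose f h1 h2 h3 h4 using hcon
  have hfin : ({g : Heis | g ∈ A ∨ g⁻¹ ∈ A} : Set Heis).Finite := by
    apply (A ∪ A.image (·⁻¹)).finite_toSet.subset
    rintro g (h | h)
    · simp [h]
    · simp only [Finset.coe_union, Set.mem_union, Finset.mem_coe, Finset.mem_image]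
      exact Or.inr ⟨g⁻¹, h, inv_inv g⟩
  have hp := Set.PartiallyWellOrderedOn.partiallyWellOrderedOn_sublistForall₂ (α := Heis) Eq
    (hfin.partiallyWellOrderedOn (r := Eq))
  haveI : IsPreorder (List Heis) (List.SublistForall₂ (Eq : Heis → Heis → Prop)) := { }
  obtain ⟨g, hg⟩ := hp.exists_monotone_subseq (f := f) (fun n x hx => h1 n x hx)
  have hsub := hg 0 (f (g 0)).length (Nat.zero_le _)
  rw [List.sublistForall₂_iff] at hsub
  obtain ⟨l, hl, hl2⟩ := hsub
  rw [List.forall₂_eq_eq_eq] at hl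
  subst hl
  have := h4 (g (f (g 0)).length) _ hl2 (h2 _) (h3 _)
  have h5 : (f (g 0)).length ≤ g (f (g 0)).length := g.strictMono.le_apply
  omega

/-- Trivial padding word. -/
def pre (a : Heis) : ℕ → List Heis
  | 0 => []
  | n + 1 => a :: a⁻¹ :: pre a n

lemma pre_word {A : Finset Heis} {a : Heis} (ha : a ∈ A) (n : ℕ) : IsWordOn A (pre a n) := by
  induction n with
  | zero => intro g hg; simp [pre] at hg
  | succ n ih =>
    intro g hg
    simp only [pre, List.mem_cons] at hg
    rcases hg with h | h | h
    · rw [h]; exact Or.inl ha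
    · rw [h, inv_inv]; exact Or.inr ha
    · exact ih g h

lemma pre_length (a : Heis) (n : ℕ) : (pre a n).length = 2 * n := by
  induction n with
  | zero => rfl
  | succ n ih => simp [pre, ih]; ring

lemma pre_prod (a : Heis) (n : ℕ) : (pre a n).prod = 1 := by
  induction n with
  | zero => rfl
  | succ n ih => simp [pre, ih]

lemma word_map_inv {A : Finset Heis} {u : List Heis} (h : IsWordOn A u) :
    IsWordOn A (u.map (·⁻¹)) := by
  intro g hg
  rw [List.mem_map] at hg
  obtain ⟨k, hk, rfl⟩ := hg
  rcases h k hk with h | h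
  · right; rwa [inv_inv]
  · left; exact h

lemma exists_word {A : Finset Heis} (hA : IsGenSet A) (g : Heis) :
    ∃ w, IsWordOn A w ∧ w.prod = g := by
  have hg : g ∈ Subgroup.closure (A : Set Heis) := by
    have : Subgroup.closure (A : Set Heis) = ⊤ := hA
    rw [this]; trivial
  induction hg using Subgroup.closure_induction with
  | mem x hx => exact ⟨[x], by intro a ha; simp at ha; rw [ha]; exact Or.inl hx, by simp⟩
  | one => exact ⟨[], by intro a ha; simp at ha, by simp⟩
  | mul x y _ _ hx hy =>
    obtain ⟨u, hu, rfl⟩ := hx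
    obtain ⟨v, hv, rfl⟩ := hy
    exact ⟨u ++ v, word_append.2 ⟨hu, hv⟩, by simp⟩
  | inv x _ hx =>
    obtain ⟨u, hu, rfl⟩ := hx
    refine ⟨(u.map (·⁻¹)).reverse, ?_, ?_⟩
    · intro a ha; exact word_map_inv hu a (List.mem_reverse.1 ha)
    · rw [List.prod_inv_reverse]

lemma wlen_word {A : Finset Heis} (hA : IsGenSet A) (g : Heis) :
    ∃ w, IsWordOn A w ∧ w.length = wlen A g ∧ w.prod = g := by
  obtain ⟨w, h1, h2⟩ := exists_word hA g
  exact Nat.sInf_mem (s := {n | ∃ w : List Heis, IsWordOn A w ∧ w.length = n ∧ w.prod = g})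
    ⟨w.length, w, h1, rfl, h2⟩

lemma wlen_le {A : Finset Heis} {w : List Heis} (h : IsWordOn A w) :
    wlen A w.prod ≤ w.length :=
  Nat.sInf_le ⟨w, h, rfl, rfl⟩

lemma word_bound {A : Finset Heis} {E T : ℝ} (c : Ctx A E T) {w : List Heis}
    (hw : IsWordOn A w) {k : ℤ} {n : ℕ} (hl : w.length = 2 * n) (hk : w.prod = Heis.z ^ k) :
    (k : ℝ) ≤ E * n ^ 2 + T * n := by
  obtain ⟨hc, ht⟩ := closed_of_prod hk
  have h1 := W_closed_split c hw hc n n (by omega)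
  have h2 := (tt_W c hw).1
  rw [ht, hl] at h2
  push_cast at h2
  linarith

lemma word_bound_abs {A : Finset Heis} {E T : ℝ} (c : Ctx A E T) {w : List Heis}
    (hw : IsWordOn A w) {k : ℤ} {n : ℕ} (hl : w.length = 2 * n) (hk : w.prod = Heis.z ^ k) :
    (k.natAbs : ℝ) ≤ E * n ^ 2 + T * n := by
  have h1 := word_bound c hw hl hk
  have h2 : ((-k : ℤ) : ℝ) ≤ E * n ^ 2 + T * n := by
    refine word_bound c (w := (w.map (·⁻¹)).reverse) ?_ (by simpa using hl) ?_
    · intro a ha; exact word_map_inv hw a (List.mem_reverse.1 ha)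
    · rw [← List.prod_inv_reverse, hk, zpow_neg]
  rw [Nat.cast_natAbs, Int.cast_abs, abs_le]
  push_cast at h2
  constructor <;> linarith

lemma IA_bdd {A : Finset Heis} (hA : IsGenSet A) {E T : ℝ} (c : Ctx A E T) (n : ℕ) :
    ∀ m ∈ {m : ℕ | ∃ k : ℤ, k.natAbs = m ∧ wlen A (Heis.z ^ k) = 2 * n},
      (m : ℝ) ≤ E * n ^ 2 + T * n := by
  rintro m ⟨k, rfl, hk⟩
  obtain ⟨w, h1, h2, h3⟩ := wlen_word hA (Heis.z ^ k)
  exact word_bound_abs c h1 (h2.trans hk) h3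

lemma IA_upper {A : Finset Heis} (hA : IsGenSet A) {E T : ℝ} (c : Ctx A E T) (n : ℕ) :
    (IA A (2 * n) : ℝ) ≤ E * n ^ 2 + T * n := by
  have hE := c.E_pos
  have hT := c.T_nn
  unfold IA
  rcases Set.eq_empty_or_nonempty
    {m : ℕ | ∃ k : ℤ, k.natAbs = m ∧ wlen A (Heis.z ^ k) = 2 * n} with h | h
  · rw [h]; simp; positivity
  · apply IA_bdd hA c n
    apply Nat.sSup_mem h
    refine ⟨⌈E * n ^ 2 + T * n⌉₊, fun m hm => ?_⟩
    have := IA_bdd hA c n m hm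
    exact_mod_cast this.trans (Nat.le_ceil _)

lemma le_IA {A : Finset Heis} (hA : IsGenSet A) {E T : ℝ} (c : Ctx A E T) {n : ℕ} {k : ℤ}
    (hk : wlen A (Heis.z ^ k) = 2 * n) : k ≤ IA A (2 * n) := by
  have : k.natAbs ≤ IA A (2 * n) := by
    apply le_csSup
    · refine ⟨⌈E * n ^ 2 + T * n⌉₊, fun m hm => ?_⟩
      have := IA_bdd hA c n m hm
      exact_mod_cast this.trans (Nat.le_ceil _)
    · exact ⟨k, rfl, hk⟩
  omega

lemma star {A : Finset Heis} (hA : IsGenSet A) {E F T : ℝ} (c : Ctx A E T) (hF : 0 ≤ F)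
    (a : Heis) (ha : a ∈ A)
    (hlow : ∀ n : ℕ, ∃ w, IsWordOn A w ∧ w.length = 2 * n ∧ ∃ k : ℤ, w.prod = Heis.z ^ k ∧
      E * n ^ 2 - F * n ≤ (k : ℝ)) :
    ∃ n0 : ℕ, ∀ n, n0 ≤ n → ∀ w, IsWordOn A w → w.length = 2 * n → ∀ k : ℤ,
      w.prod = Heis.z ^ k → k ≤ IA A (2 * n) := by
  have hE := c.E_pos
  have hT := c.T_nn
  obtain ⟨K, hK⟩ := odd_sublist A
  choose N hN using fun d => improve c (2 * F) (by positivity) d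
  obtain ⟨N1, hN1⟩ := exists_nat_gt ((2 * F + T + E) / E)
  rw [div_lt_iff₀ hE] at hN1
  set N2 := (Finset.range (K + 1)).sup N with hN2
  have hNle : ∀ d, d ≤ K → N d ≤ N2 := fun d hd =>
    Finset.le_sup (f := N) (Finset.mem_range.2 (by omega))
  refine ⟨N1 + N2 + 1, fun n hn w hw hl k hk => ?_⟩
  obtain ⟨ks, ⟨ws, s1, s2, s3⟩, hmax⟩ := Int.exists_greatest_of_bdd
    (P := fun k : ℤ => ∃ w, IsWordOn A w ∧ w.length = 2 * n ∧ w.prod = Heis.z ^ k)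
    ⟨⌈E * n ^ 2 + T * n⌉, by
      rintro z ⟨v, v1, v2, v3⟩
      have := word_bound c v1 v2 v3
      exact_mod_cast this.trans (Int.le_ceil _)⟩ ⟨k, w, hw, hl, hk⟩
  refine (hmax k ⟨w, hw, hl, hk⟩).trans ?_
  have hmaxe : ∀ v, IsWordOn A v → Closed v → Even v.length → v.length ≤ 2 * n →
      tt v.prod ≤ 2 * ks := by
    intro v v1 v2 v3 v4
    obtain ⟨j, hj, hj2⟩ := closed_prod v2
    rw [hj2]
    obtain ⟨r, hr⟩ := v3
    have := hmax j ⟨pre a (n - r) ++ v, word_append.2 ⟨pre_word ha _, v1⟩, by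
      rw [List.length_append, pre_length]; omega, by
      rw [List.prod_append, pre_prod, one_mul, hj]⟩
    linarith
  obtain ⟨v0, p1, p2, k0, p3, p4⟩ := hlow n
  have hks : E * n ^ 2 - F * n ≤ (ks : ℝ) := by
    have : (k0 : ℝ) ≤ ks := by exact_mod_cast hmax k0 ⟨v0, p1, p2, p3⟩
    linarith
  obtain ⟨v, v1, v2, v3⟩ := wlen_word hA (Heis.z ^ ks)
  have hm : wlen A (Heis.z ^ ks) ≤ 2 * n := by
    rw [← s3, ← s2]; exact wlen_le s1
  rcases hm.lt_or_eq with hlt | heq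
  swap
  · exact le_IA hA c heq
  exfalso
  rw [← v2] at hlt
  obtain ⟨vc, vt⟩ := closed_of_prod v3
  have hvt : (tt v.prod : ℝ) = 2 * ks := by rw [vt]; push_cast; ring
  have hnN : (N1 : ℝ) + 1 ≤ n := by exact_mod_cast (by omega : N1 + 1 ≤ n)
  have hn1 : (1 : ℝ) ≤ n := by exact_mod_cast (by omega : 1 ≤ n)
  have hmn : n ≤ v.length := by
    by_contra! hcon
    have h1 := tt_closed c v1 vc
    have h2 : (v.length : ℝ) ≤ n := by exact_mod_cast hcon.le
    have h3 : (v.length : ℝ) ^ 2 ≤ (n : ℝ) ^ 2 := by gcongr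
    have h4 : E * (v.length : ℝ) ^ 2 ≤ E * (n : ℝ) ^ 2 := by gcongr
    have h5 : T * (v.length : ℝ) ≤ T * n := by gcongr
    have h6 : (2 * F + T + E) * n ≤ (N1 * E) * n := by gcongr
    have h7 : N1 * (E * n) ≤ (n - 1) * (E * n) :=
      mul_le_mul_of_nonneg_right (by linarith) (by positivity)
    have h8 : E * 1 ≤ E * n := by gcongr
    have h9 : 0 ≤ E * (n : ℝ) ^ 2 := by positivity
    rw [hvt] at h1
    linarith
  have hmn' : (n : ℝ) ≤ v.length := by exact_mod_cast hmn
  have hm2 : (v.length : ℝ) ≤ 2 * n := by exact_mod_cast hlt.le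
  have hlow' : E * v.length ^ 2 / 2 - 2 * F * v.length ≤ tt v.prod := by
    have h3 : (v.length : ℝ) ^ 2 ≤ (2 * n : ℝ) ^ 2 := by gcongr
    have h4 : E * (v.length : ℝ) ^ 2 ≤ E * (2 * n : ℝ) ^ 2 := by gcongr
    have h5 : F * n ≤ F * (v.length : ℝ) := by gcongr
    rw [hvt]
    linarith
  rcases Nat.even_or_odd v.length with he | ho
  · obtain ⟨v', q1, q2, q3, q4⟩ := hN 0 v v1 vc (by have := hNle 0 (by omega); omega) hlow'
      [] (List.nil_sublist _) ⟨rfl, rfl⟩ rfl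
    have he' := he
    obtain ⟨r, hr⟩ := he'
    have := hmaxe v' q1 q2 ⟨r + 1, by omega⟩ (by omega)
    omega
  · obtain ⟨l, l1, l2, l3, l4⟩ := hK v v1 vc ho
    obtain ⟨v', q1, q2, q3, q4⟩ := hN l.length v v1 vc (by have := hNle _ l4; omega) hlow'
      l l1 l2 rfl
    obtain ⟨r, hr⟩ := ho
    obtain ⟨s, hs⟩ := l3
    have := hmaxe v' q1 q2 ⟨r + 1, by omega⟩ (by omega)
    omega

end HF

/-- Proposition `fattest`. For every finite generating set `A` of the
discrete Heisenberg group there exist `D, E, F ∈ ℝ` with `E > 0` and, for each `n`, a word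
`w_n` of length `2n` in the letters of `A ∪ A⁻¹`, such that each `w_{n+1}` is obtained from
`w_n` by inserting a letter of `A ∪ A⁻¹` and its inverse (not necessarily adjacently), and
each `w_n` represents `z^{k_n}` with `I_A(2n) − Dn ≤ k_n ≤ I_A(2n)` and
`En² − Fn ≤ k_n ≤ En²`. -/
theorem heisenberg_fattest
    (A : Finset Heis) (hA : IsGenSet A) :
    ∃ D E F : ℝ, 0 < E ∧
      ∃ (w : ℕ → List Heis) (k : ℕ → ℤ),
        (∀ n, IsWordOn A (w n)) ∧
        (∀ n, (w n).length = 2 * n) ∧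
        (∀ n : ℕ, ∃ a : Heis, (a ∈ A ∨ a⁻¹ ∈ A) ∧ ∃ u₁ u₂ u₃ : List Heis,
          w n = u₁ ++ u₂ ++ u₃ ∧ w (n + 1) = u₁ ++ a :: (u₂ ++ a⁻¹ :: u₃)) ∧
        (∀ n, (w n).prod = Heis.z ^ (k n)) ∧
        (∀ n : ℕ, (IA A (2 * n) : ℝ) - D * n ≤ (k n : ℝ) ∧ (k n : ℝ) ≤ (IA A (2 * n) : ℝ) ∧
          E * n ^ 2 - F * n ≤ (k n : ℝ) ∧ (k n : ℝ) ≤ E * n ^ 2) := by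
  obtain ⟨E, F, T, hE, hF, hT, hup, htau, u, u1, u2, u3, u4⟩ := HF.main_E A hA
  have c : HF.Ctx A E T := ⟨hE, hT, hup, htau⟩
  obtain ⟨a, ha, -⟩ := HF.exists_wedge_ne A hA
  have s1 : ∀ n, IsWordOn A (u n ++ (u n).map (·⁻¹)) := fun n =>
    HF.word_append.2 ⟨u1 n, HF.word_map_inv (u1 n)⟩
  have s2 : ∀ n, (u n ++ (u n).map (·⁻¹)).length = 2 * n := by
    intro n; rw [List.length_append, List.length_map, u2]; omega
  obtain ⟨n0, hn0⟩ := HF.star hA c hF a ha (fun n => ⟨u n ++ (u n).map (·⁻¹), s1 n, s2 n,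
    HF.W (u n), HF.sym_prod _, u4 n⟩)
  have hu0 : u 0 = [] := List.eq_nil_of_length_eq_zero (u2 0)
  set w : ℕ → List Heis := fun n =>
    HF.pre a (min n n0) ++ (u (n - n0) ++ (u (n - n0)).map (·⁻¹)) with hw
  have w1 : ∀ n, IsWordOn A (w n) := fun n => HF.word_append.2 ⟨HF.pre_word ha _, s1 _⟩
  have w2 : ∀ n, (w n).length = 2 * n := by
    intro n
    simp only [hw]
    rw [List.length_append, HF.pre_length, s2]; omega
  have w3 : ∀ n, (w n).prod = Heis.z ^ (HF.W (u (n - n0))) := by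
    intro n
    simp only [hw]
    rw [List.prod_append, HF.pre_prod, one_mul, HF.sym_prod]
  have hlo : ∀ n : ℕ, E * n ^ 2 - (F + 2 * E * n0) * n ≤ (HF.W (u (n - n0)) : ℝ) := by
    intro n
    have h0 : (0 : ℝ) ≤ n := by positivity
    rcases le_total n0 n with h | h
    · have h1 := u4 (n - n0)
      rw [Nat.cast_sub h] at h1
      have h2 : 0 ≤ F * n0 := by positivity
      have h3 : 0 ≤ E * (n0 : ℝ) ^ 2 := by positivity
      linarith
    · rw [Nat.sub_eq_zero_of_le h, hu0]
      have h1 : (n : ℝ) ≤ n0 := by exact_mod_cast h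
      have h2 : E * n * n ≤ E * n * n0 := by gcongr
      have h3 : 0 ≤ F * n := by positivity
      have h4 : 0 ≤ E * n * n0 := by positivity
      rw [HF.W_nil]; push_cast
      linarith
  refine ⟨F + 2 * E * n0 + T, E, F + 2 * E * n0, hE, w, fun n => HF.W (u (n - n0)), w1, w2, ?_,
    w3, ?_⟩
  · intro n
    rcases lt_or_ge n n0 with h | h
    · refine ⟨a, Or.inl ha, [], [], w n, rfl, ?_⟩
      have e1 : min (n + 1) n0 = n + 1 := by omega
      have e2 : min n n0 = n := by omega
      have e3 : n + 1 - n0 = 0 := by omega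
      have e4 : n - n0 = 0 := by omega
      simp [hw, e1, e2, e3, e4, HF.pre]
    · obtain ⟨g, x, y, hg, h1, h2⟩ := u3 (n - n0)
      refine ⟨g, hg, HF.pre a n0 ++ x, y ++ x.map (·⁻¹), y.map (·⁻¹), ?_, ?_⟩
      · have e1 : min n n0 = n0 := by omega
        simp [hw, e1, h1]
      · have e1 : min (n + 1) n0 = n0 := by omega
        have e2 : n + 1 - n0 = n - n0 + 1 := by omega
        simp [hw, e1, e2, h2]
  · intro n
    beta_reduce
    refine ⟨?_, ?_, hlo n, ?_⟩
    · have h1 := hlo n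
      have h2 := HF.IA_upper hA c n
      linarith
    · rcases lt_or_ge n n0 with h | h
      · rw [Nat.sub_eq_zero_of_le h.le, hu0]; simp
      · exact_mod_cast hn0 n h (w n) (w1 n) (w2 n) _ (w3 n)
    · have h1 := (hup _ (u1 (n - n0))).1
      rw [u2] at h1
      have h2 : ((n - n0 : ℕ) : ℝ) ≤ n := by exact_mod_cast Nat.sub_le n n0
      have h3 : E * ((n - n0 : ℕ) : ℝ) ^ 2 ≤ E * (n : ℝ) ^ 2 := by gcongr
      exact h1.trans h3
end

section
/- Let A be a finite generating set for the discrete Heisenberg group H. Then there exist constants C, D, E ∈ ℤ with the following property. For every n ∈ ℤ there exists n' ∈ ℤ with |n − n'| ≤ C such that, for every v = (v₁, v₂) ∈ ℤ² with |v₁| + |v₂| ≤ |n|^{1/6}, there exist words w and w' in the letters of A ∪ A⁻¹ such that: (1) w represents z^{n'}; (2) l(w) ≤ |z^{n'}|_A + D; (3) the image of w' in ℤ² under the abelianization map φ equals v; (4) l(w) ≥ l(w') − E; (5) w and w' share a common terminal segment w₂, i.e. w = u w₂ and w' = u' w₂ for words u, u', with l(u) + l(u') ≤ |n'|^{1/5}.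 -/
/-- The determinant of the abelianized vectors. -/
def dt (g h : Heis) : ℤ := g.a * h.b - h.a * g.b

/-- Twice the signed area coordinate. -/
def sg (g : Heis) : ℤ := 2 * g.c - g.a * g.b

lemma sg_mul (g h : Heis) : sg (g * h) = sg g + sg h + dt g h := by
  simp [sg, dt]; ring
lemma sg_inv (g : Heis) : sg g⁻¹ = - sg g := by simp [sg]; ring
lemma sg_one : sg 1 = 0 := by simp [sg]
lemma dt_mul_right (g h k : Heis) : dt g (h * k) = dt g h + dt g k := by simp [dt]; ring
lemma dt_mul_left (g h k : Heis) : dt (g * h) k = dt g k + dt h k := by simp [dt]; ring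
lemma dt_one_right (g : Heis) : dt g 1 = 0 := by simp [dt]
lemma dt_one_left (g : Heis) : dt 1 g = 0 := by simp [dt]
lemma dt_inv_left (g h : Heis) : dt g⁻¹ h = - dt g h := by simp [dt]; ring
lemma dt_inv_right (g h : Heis) : dt g h⁻¹ = - dt g h := by simp [dt]; ring
lemma dt_self (g : Heis) : dt g g = 0 := by simp [dt]
lemma dt_swap (g h : Heis) : dt g h = - dt h g := by simp [dt]

lemma dt_pow_left (g h : Heis) (k : ℕ) : dt (g ^ k) h = k * dt g h := by
  induction k with
  | zero => simp [dt_one_left]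
  | succ k ih => rw [pow_succ, dt_mul_left, ih]; push_cast; ring
lemma sg_pow (g : Heis) (k : ℕ) : sg (g ^ k) = k * sg g := by
  induction k with
  | zero => simp [sg_one]
  | succ k ih => rw [pow_succ, sg_mul, ih, dt_pow_left, dt_self]; push_cast; ring

lemma pow_a (g : Heis) (k : ℕ) : (g ^ k).a = k * g.a := by
  induction k with
  | zero => simp
  | succ k ih => rw [pow_succ, Heis.mul_a, ih]; push_cast; ring
lemma pow_b (g : Heis) (k : ℕ) : (g ^ k).b = k * g.b := by
  induction k with
  | zero => simp
  | succ k ih => rw [pow_succ, Heis.mul_b, ih]; push_cast; ring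

lemma z_pow_nat (k : ℕ) : Heis.z ^ k = ⟨0, 0, k⟩ := by
  induction k with
  | zero => rfl
  | succ k ih => rw [pow_succ, ih]; ext <;> simp [Heis.z]

lemma z_zpow (k : ℤ) : Heis.z ^ k = ⟨0, 0, k⟩ := by
  cases k with
  | ofNat k => simpa using z_pow_nat k
  | negSucc k =>
    rw [zpow_negSucc, z_pow_nat]; ext <;> simp [Int.negSucc_eq]

/-- double sums over a list -/
def DS {α : Type*} (w : List α) (F : α → α → ℝ) : ℝ :=
  (w.map fun x => (w.map fun y => F x y).sum).sum

lemma DS_cons {α : Type*} (F : α → α → ℝ) (hs : ∀ a b, F a b = F b a) (h0 : ∀ a, F a a = 0)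
    (a : α) (w : List α) : DS (a :: w) F = DS w F + 2 * (w.map (F a)).sum := by
  have : (fun x => F x a) = F a := by funext x; exact hs x a
  simp only [DS, List.map_cons, List.sum_cons, List.sum_map_add, h0, this]
  ring

/-- real absolute determinant -/
noncomputable def ad (g h : Heis) : ℝ := |(dt g h : ℝ)|

lemma ad_symm (g h : Heis) : ad g h = ad h g := by
  simp [ad, dt_swap g h]
lemma ad_self (g : Heis) : ad g g = 0 := by simp [ad, dt_self]
lemma ad_nonneg (g h : Heis) : 0 ≤ ad g h := abs_nonneg _
lemma ad_inv_left (g h : Heis) : ad g⁻¹ h = ad g h := by simp [ad, dt_inv_left]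
lemma ad_inv_right (g h : Heis) : ad g h⁻¹ = ad g h := by simp [ad, dt_inv_right]

lemma dt_prod_le (g : Heis) (w : List Heis) : |(dt g w.prod : ℝ)| ≤ (w.map (ad g)).sum := by
  induction w with
  | nil => simp [dt_one_right]
  | cons a w ih =>
    simp only [List.prod_cons, List.map_cons, List.sum_cons, dt_mul_right]
    push_cast
    exact (abs_add_le _ _).trans (add_le_add le_rfl ih)

lemma sg_prod_le (K : ℝ) (w : List Heis) (hK : ∀ a ∈ w, |(sg a : ℝ)| ≤ K) :
    |(sg w.prod : ℝ)| ≤ K * w.length + DS w ad / 2 := by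
  induction w with
  | nil => simp [sg_one, DS]
  | cons a w ih =>
    have h1 := ih (fun b hb => hK b (List.mem_cons_of_mem _ hb))
    have h2 := hK a (List.mem_cons_self)
    have h3 := dt_prod_le a w
    rw [DS_cons ad ad_symm ad_self, List.prod_cons, sg_mul]
    push_cast [List.length_cons]
    have := abs_add_le ((sg a : ℝ) + sg w.prod) (dt a w.prod)
    have := abs_add_le (sg a : ℝ) (sg w.prod)
    linarith

lemma exists_max {α : Type*} [DecidableEq α] (S : Finset α) (hS : S.Nonempty) (F : α → α → ℝ) :
    ∃ κ : α → ℝ, (∀ a, 0 ≤ κ a) ∧ (∑ a ∈ S, κ a = 1) ∧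
      ∀ w : List α, (∀ a ∈ w, a ∈ S) →
        DS w F ≤ (∑ a ∈ S, ∑ b ∈ S, κ a * κ b * F a b) * (w.length : ℝ) ^ 2 := by
  have : Nonempty S := hS.to_subtype
  let Q : (S → ℝ) → ℝ := fun κ => ∑ a, ∑ b, κ a * κ b * F a b
  have hQ : Continuous Q := by fun_prop
  obtain ⟨κ, hκ, hmax⟩ := (isCompact_stdSimplex ℝ S).exists_isMaxOn
    (by
      obtain ⟨a⟩ := ‹Nonempty S›
      exact ⟨_, single_mem_stdSimplex ℝ a⟩) hQ.continuousOn
  refine ⟨fun a => if h : a ∈ S then κ ⟨a, h⟩ else 0, ?_, ?_, ?_⟩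
  · intro a
    by_cases h : a ∈ S
    · simpa [h] using hκ.1 ⟨a, h⟩
    · simp [h]
  · rw [← Finset.sum_coe_sort]
    simpa using hκ.2
  · intro w hw
    have e1 : (∑ a ∈ S, ∑ b ∈ S, (if h : a ∈ S then κ ⟨a, h⟩ else 0) *
        (if h : b ∈ S then κ ⟨b, h⟩ else 0) * F a b) = Q κ := by
      rw [← Finset.sum_coe_sort]
      refine Finset.sum_congr rfl fun a _ => ?_
      rw [← Finset.sum_coe_sort]
      refine Finset.sum_congr rfl fun b _ => ?_
      simp
    rw [e1]
    have key : ∀ f : α → ℝ, (w.map f).sum = ∑ a : S, (w.count a.1 : ℝ) * f a := by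
      intro f
      rw [Finset.sum_list_map_count, Finset.sum_coe_sort S (fun a => (w.count a : ℝ) * f a)]
      simp only [nsmul_eq_mul]
      refine Finset.sum_subset (fun a ha => hw a (by simpa using ha)) ?_
      intro a _ ha
      have : w.count a = 0 := List.count_eq_zero.2 (by simpa using ha)
      simp [this]
    rcases w.eq_nil_or_concat with h | h
    · subst h; simp [DS]
    have hl : (0 : ℝ) < w.length := by
      rcases h with ⟨_, _, rfl⟩; simp; positivity
    let κw : S → ℝ := fun a => (w.count a.1 : ℝ) / w.length
    have hm : κw ∈ stdSimplex ℝ S := by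
      refine ⟨fun a => by positivity, ?_⟩
      have := key (fun _ => 1)
      simp only [κw]
      rw [← Finset.sum_div, div_eq_one_iff_eq hl.ne']
      simpa using this.symm
    have h1 : Q κw ≤ Q κ := hmax hm
    have h2 : DS w F = Q κw * (w.length : ℝ) ^ 2 := by
      simp only [DS, Q, κw]
      rw [key, Finset.sum_mul]
      refine Finset.sum_congr rfl fun a _ => ?_
      rw [key, Finset.sum_mul, Finset.mul_sum]
      refine Finset.sum_congr rfl fun b _ => ?_
      field_simp
    rw [h2]
    gcongr

lemma lower_bound (S : Finset Heis) (c K : ℝ) (hc : 0 < c) (hK : 0 ≤ K)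
    (hKS : ∀ a ∈ S, |(sg a : ℝ)| ≤ K)
    (hDS : ∀ w : List Heis, (∀ a ∈ w, a ∈ S) → DS w ad ≤ c * (w.length : ℝ) ^ 2)
    (w : List Heis) (hw : ∀ a ∈ w, a ∈ S) (n : ℤ) (hn : w.prod = Heis.z ^ n) :
    √(8 * n / c) ≤ w.length + (2 * K / c + 1) := by
  set m := w.length / 2 with hm
  have h1 : ∀ a ∈ w.take m, a ∈ S := fun a ha => hw a (List.mem_of_mem_take ha)
  have h2 : ∀ a ∈ w.drop m, a ∈ S := fun a ha => hw a (List.mem_of_mem_drop ha)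
  have e : (w.take m).prod * (w.drop m).prod = Heis.z ^ n := by
    rw [← List.prod_append, List.take_append_drop, hn]
  have s1 := sg_prod_le K _ (fun a ha => hKS a (h1 a ha))
  have s2 := sg_prod_le K _ (fun a ha => hKS a (h2 a ha))
  have d1 := hDS _ h1
  have d2 := hDS _ h2
  generalize (w.take m).prod = P at *
  generalize (w.drop m).prod = R at *
  have e2 : sg P + sg R = 2 * n := by
    rw [z_zpow] at e
    have ea := congrArg Heis.a e
    have eb := congrArg Heis.b e
    have ec := congrArg sg e
    rw [sg_mul] at ec
    simp only [Heis.mul_a, Heis.mul_b] at ea eb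
    have : dt P R = 0 := by
      have ea' : R.a = - P.a := by linarith
      have eb' : R.b = - P.b := by linarith
      simp [dt, ea', eb']
    rw [this] at ec
    simpa [sg] using ec
  have e3 : (sg P : ℝ) + sg R = 2 * n := by exact_mod_cast e2
  have l1 : ((w.take m).length : ℝ) + (w.drop m).length = w.length := by
    norm_cast; rw [← List.length_append, List.take_append_drop]
  have l2 : ((w.take m).length : ℝ) ≤ (w.drop m).length ∧
      ((w.drop m).length : ℝ) ≤ (w.take m).length + 1 := by
    norm_cast; simp; omega
  generalize ((w.take m).length : ℝ) = x at *
  generalize ((w.drop m).length : ℝ) = y at *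
  have hl : (0 : ℝ) ≤ w.length := by positivity
  generalize (w.length : ℝ) = l at *
  have q : x ^ 2 + y ^ 2 ≤ (l ^ 2 + 1) / 2 := by
    have : (y - x) ^ 2 ≤ 1 := by nlinarith
    subst l1; nlinarith
  have f : 2 * (n : ℝ) ≤ K * l + c / 4 * (l ^ 2 + 1) := by
    have := le_abs_self (sg P : ℝ)
    have := le_abs_self (sg R : ℝ)
    have : c * (x ^ 2 + y ^ 2) ≤ c * ((l ^ 2 + 1) / 2) := by gcongr
    have : K * l = K * x + K * y := by rw [← l1]; ring
    linarith
  apply Real.sqrt_le_iff.2 ⟨by positivity, ?_⟩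
  rw [div_le_iff₀ hc]
  have : (l + (2 * K / c + 1)) ^ 2 * c =
      c * l ^ 2 + 4 * K * l + c + 2 * l * c + 4 * K ^ 2 / c + 4 * K := by
    field_simp; ring
  rw [this]
  have : 0 ≤ 4 * K ^ 2 / c := by positivity
  have : 0 ≤ l * c := by positivity
  linarith

/-- strict half-plane -/
def NH (g : Heis) : Prop := 0 < g.b ∨ (g.b = 0 ∧ 0 < g.a)

/-- slope key for sorting by angle -/
def key (g : Heis) : WithBot ℚ := if g.b = 0 then ⊥ else ((-g.a / g.b : ℚ) : WithBot ℚ)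

lemma key_pos {g : Heis} (h : 0 < g.b) : key g = ((-g.a / g.b : ℚ) : WithBot ℚ) := by
  simp [key, h.ne']

lemma dt_of_key_le {g h : Heis} (hg : NH g) (hh : NH h) (hk : key g ≤ key h) : 0 ≤ dt g h := by
  rcases hg with hg | ⟨hg, hg'⟩ <;> rcases hh with hh | ⟨hh, hh'⟩
  · rw [key_pos hg, key_pos hh, WithBot.coe_le_coe] at hk
    have a1 : (0 : ℚ) < g.b := by exact_mod_cast hg
    have a2 : (0 : ℚ) < h.b := by exact_mod_cast hh
    rw [div_le_div_iff₀ a1 a2] at hk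
    have : -g.a * h.b ≤ -h.a * g.b := by exact_mod_cast hk
    simp only [dt]; linarith
  · rw [key_pos hg] at hk
    simp [key, hh] at hk
  · simp only [dt, hg]; nlinarith
  · simp [dt, hg, hh]

lemma dt_of_key_eq {g h : Heis} (hg : NH g) (hh : NH h) (hk : key g = key h) : dt g h = 0 :=
  le_antisymm (by rw [dt_swap]; linarith [dt_of_key_le hh hg hk.ge]) (dt_of_key_le hg hh hk.le)

lemma dt_of_key_lt {g h : Heis} (hg : NH g) (hh : NH h) (hk : key g < key h) : 0 < dt g h := by
  rcases hg with hg | ⟨hg, hg'⟩ <;> rcases hh with hh | ⟨hh, hh'⟩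
  · rw [key_pos hg, key_pos hh, WithBot.coe_lt_coe] at hk
    have a1 : (0 : ℚ) < g.b := by exact_mod_cast hg
    have a2 : (0 : ℚ) < h.b := by exact_mod_cast hh
    rw [div_lt_div_iff₀ a1 a2] at hk
    have : -g.a * h.b < -h.a * g.b := by exact_mod_cast hk
    simp only [dt]; linarith
  · rw [key_pos hg] at hk
    simp [key, hh] at hk
  · simp only [dt, hg]; nlinarith
  · simp [key, hg, hh] at hk

open Classical in
/-- normalise to the half-plane -/
noncomputable def nm (g : Heis) : Heis := if NH g then g else g⁻¹

lemma nm_NH {g : Heis} (h : ¬ (g.a = 0 ∧ g.b = 0)) : NH (nm g) := by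
  unfold nm
  split_ifs with h1
  · exact h1
  · unfold NH at *; simp only [Heis.inv_a, Heis.inv_b]; omega

lemma nm_eq (g : Heis) : nm g = g ∨ nm g = g⁻¹ := by
  unfold nm; split_ifs <;> simp

lemma ad_nm_left (g h : Heis) : ad (nm g) h = ad g h := by
  rcases nm_eq g with e | e <;> rw [e]; exact ad_inv_left _ _
lemma ad_nm_right (g h : Heis) : ad g (nm h) = ad g h := by
  rw [ad_symm, ad_nm_left, ad_symm]

/-- weighted determinant -/
noncomputable def wad (x y : Heis × ℝ) : ℝ := x.2 * y.2 * ad x.1 y.1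

lemma DS_perm {α : Type*} {l l' : List α} (h : l.Perm l') (F : α → α → ℝ) : DS l F = DS l' F := by
  unfold DS
  have : (fun x => (l.map fun y => F x y).sum) = (fun x => (l'.map fun y => F x y).sum) := by
    funext x; exact (h.map _).sum_eq
  rw [this]
  exact (h.map _).sum_eq

lemma exists_list (S : Finset Heis) (hinv : ∀ a ∈ S, a⁻¹ ∈ S) (κ : Heis → ℝ)
    (h0 : ∀ a, 0 ≤ κ a) (h1 : ∑ a ∈ S, κ a = 1) :
    ∃ L : List (Heis × ℝ), (∀ x ∈ L, x.1 ∈ S ∧ 0 < x.2 ∧ x.2 ≤ 1 ∧ NH x.1) ∧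
      (L.map Prod.snd).sum ≤ 1 ∧
      DS L wad = ∑ a ∈ S, ∑ b ∈ S, κ a * κ b * ad a b ∧
      L.Pairwise (fun x y => key x.1 ≤ key y.1) := by
  classical
  let T := S.filter (fun a => 0 < κ a ∧ ¬ (a.a = 0 ∧ a.b = 0))
  have hT : T ⊆ S := Finset.filter_subset _ _
  let L0 := T.toList.map (fun a => (nm a, κ a))
  let r : Heis × ℝ → Heis × ℝ → Prop := fun x y => key x.1 ≤ key y.1
  have : Std.Total r := ⟨fun x y => le_total _ _⟩
  have : IsTrans _ r := ⟨fun x y z => le_trans⟩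
  have hp : (L0.insertionSort r).Perm L0 := List.perm_insertionSort r L0
  refine ⟨L0.insertionSort r, ?_, ?_, ?_, List.pairwise_insertionSort r L0⟩
  · intro x hx
    rw [hp.mem_iff] at hx
    simp only [L0, List.mem_map, Finset.mem_toList, T, Finset.mem_filter] at hx
    obtain ⟨a, ⟨ha, hk, hz⟩, rfl⟩ := hx
    refine ⟨?_, hk, ?_, nm_NH hz⟩
    · rcases nm_eq a with e | e <;> simp only [e]
      exacts [ha, hinv a ha]
    · rw [← h1]; exact Finset.single_le_sum (fun b _ => h0 b) ha
  · rw [(hp.map _).sum_eq, ← h1]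
    simp only [L0, List.map_map]
    rw [Finset.sum_map_toList]
    exact Finset.sum_le_sum_of_subset_of_nonneg hT (fun b _ _ => h0 b)
  · rw [DS_perm hp]
    simp only [DS, L0, List.map_map]
    rw [Finset.sum_map_toList]
    have van : ∀ a ∈ S, a ∉ T → ∀ b, κ a * κ b * ad a b = 0 := by
      intro a ha hat b
      simp only [T, Finset.mem_filter, not_and] at hat
      by_cases hk : 0 < κ a
      · have hh := hat ha hk
        have : a.a = 0 ∧ a.b = 0 := by tauto
        simp [ad, dt, this]
      · have : κ a = 0 := le_antisymm (not_lt.1 hk) (h0 a)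
        simp [this]
    rw [← Finset.sum_subset hT (f := fun a => ∑ b ∈ S, κ a * κ b * ad a b)]
    · refine Finset.sum_congr rfl fun a ha => ?_
      simp only [Function.comp_def]
      rw [Finset.sum_map_toList, ← Finset.sum_subset hT (f := fun b => κ a * κ b * ad a b)]
      · refine Finset.sum_congr rfl fun b hb => ?_
        simp [wad, ad_nm_left, ad_nm_right]
      · intro b hb hbt
        have := van b hb hbt a
        rw [ad_symm]; linarith
    · intro a ha hat
      exact Finset.sum_eq_zero fun b _ => van a ha hat b

lemma exists_split {α : Type*} {R : α → α → Prop} {l : List α} (h : ¬ l.IsChain R) :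
    ∃ l₁ p q l₂, l = l₁ ++ p :: q :: l₂ ∧ ¬ R p q := by
  induction l with
  | nil => simp at h
  | cons a l ih =>
    cases l with
    | nil => simp at h
    | cons b l =>
      by_cases hab : R a b
      · obtain ⟨l₁, p, q, l₂, e, hR⟩ := ih (fun hc => h (List.isChain_cons_cons.2 ⟨hab, hc⟩))
        exact ⟨a :: l₁, p, q, l₂, by simp [e], hR⟩
      · exact ⟨[], a, b, l, rfl, hab⟩

lemma exists_corner (L : List (Heis × ℝ)) (hL : ∀ x ∈ L, NH x.1)
    (hs : L.Pairwise (fun x y => key x.1 ≤ key y.1)) (hpos : DS L wad ≠ 0) :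
    ∃ L₁ p q L₂, L = L₁ ++ p :: q :: L₂ ∧ 0 < dt p.1 q.1 := by
  by_cases hc : L.IsChain (fun x y => key x.1 = key y.1)
  · exfalso; apply hpos
    let _ : Trans (fun x y : Heis × ℝ => key x.1 = key y.1)
      (fun x y : Heis × ℝ => key x.1 = key y.1)
      (fun x y : Heis × ℝ => key x.1 = key y.1) := ⟨fun h1 h2 => h1.trans h2⟩
    rw [List.isChain_iff_pairwise] at hc
    have : Std.Symm (fun x y : Heis × ℝ => key x.1 = key y.1) := ⟨fun _ _ h => h.symm⟩
    have hall : ∀ x ∈ L, ∀ y ∈ L, key x.1 = key y.1 :=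
      fun x hx y hy => List.Pairwise.forall_of_forall
        (R := fun x y : Heis × ℝ => key x.1 = key y.1) (fun _ _ => rfl) hc hx hy
    unfold DS
    have : ∀ x ∈ L, (L.map fun y => wad x y).sum = 0 := by
      intro x hx
      apply List.sum_eq_zero
      intro v hv
      obtain ⟨y, hy, rfl⟩ := List.mem_map.1 hv
      simp [wad, ad, dt_of_key_eq (hL x hx) (hL y hy) (hall x hx y hy)]
    apply List.sum_eq_zero
    intro v hv
    obtain ⟨y, hy, rfl⟩ := List.mem_map.1 hv
    exact this y hy
  · obtain ⟨l₁, p, q, l₂, e, hR⟩ := exists_split hc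
    refine ⟨l₁, p, q, l₂, e, ?_⟩
    subst e
    have hle : key p.1 ≤ key q.1 := by
      have := (List.pairwise_append.1 hs).2.1
      exact (List.pairwise_cons.1 this).1 q (by simp)
    exact dt_of_key_lt (hL p (by simp)) (hL q (by simp)) (lt_of_le_of_ne hle hR)

/-- the ascending half of the polygon word -/
def up (L : List (Heis × ℕ)) : List Heis := L.flatMap fun x => List.replicate x.2 x.1
/-- the descending half of the polygon word -/
def dn (L : List (Heis × ℕ)) : List Heis := L.flatMap fun x => List.replicate x.2 x.1⁻¹

lemma up_cons (x : Heis × ℕ) (L) : up (x :: L) = List.replicate x.2 x.1 ++ up L := by simp [up]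
lemma dn_cons (x : Heis × ℕ) (L) : dn (x :: L) = List.replicate x.2 x.1⁻¹ ++ dn L := by simp [dn]
lemma up_append (L L') : up (L ++ L') = up L ++ up L' := by simp [up]
lemma dn_append (L L') : dn (L ++ L') = dn L ++ dn L' := by simp [dn]

lemma up_length (L : List (Heis × ℕ)) : (up L).length = (L.map Prod.snd).sum := by
  induction L with
  | nil => rfl
  | cons x L ih => simp [up_cons, ih]
lemma dn_length (L : List (Heis × ℕ)) : (dn L).length = (L.map Prod.snd).sum := by
  induction L with
  | nil => rfl
  | cons x L ih => simp [dn_cons, ih]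

lemma dn_a (L : List (Heis × ℕ)) : (dn L).prod.a = - (up L).prod.a := by
  induction L with
  | nil => simp [up, dn]
  | cons x L ih => simp [up_cons, dn_cons, ih, pow_a]; ring
lemma dn_b (L : List (Heis × ℕ)) : (dn L).prod.b = - (up L).prod.b := by
  induction L with
  | nil => simp [up, dn]
  | cons x L ih => simp [up_cons, dn_cons, ih, pow_b]; ring

lemma dt_up (g : Heis) (L : List (Heis × ℕ)) (h : ∀ x ∈ L, 0 ≤ dt g x.1) :
    (dt g (up L).prod : ℝ) = (L.map fun y => (y.2 : ℝ) * ad g y.1).sum := by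
  induction L with
  | nil => simp [up, dt_one_right]
  | cons x L ih =>
    have h1 := ih (fun y hy => h y (List.mem_cons_of_mem _ hy))
    have h2 := h x (List.mem_cons_self)
    have h3 : ad g x.1 = (dt g x.1 : ℝ) := by
      unfold ad; rw [abs_of_nonneg]; exact_mod_cast h2
    rw [up_cons, List.prod_append, dt_mul_right, List.map_cons, List.sum_cons, ← h1,
      List.prod_replicate, dt_swap, dt_pow_left, h3, dt_swap x.1 g]
    push_cast; ring

lemma sg_up_dn (L : List (Heis × ℕ)) (h : L.Pairwise (fun x y => 0 ≤ dt x.1 y.1)) :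
    ((sg (up L).prod : ℝ) + sg (dn L).prod) =
      DS L (fun x y => (x.2 : ℝ) * y.2 * ad x.1 y.1) := by
  induction L with
  | nil => simp [up, dn, sg_one, DS]
  | cons x L ih =>
    rw [List.pairwise_cons] at h
    rw [DS_cons _ (fun a b => by rw [ad_symm]; ring) (fun a => by rw [ad_self]; ring),
      ← ih h.2, up_cons, dn_cons, List.prod_append, List.prod_append, sg_mul, sg_mul,
      List.prod_replicate, List.prod_replicate, sg_pow, sg_pow, sg_inv]
    have h1 := dt_up x.1 L h.1
    have h2 : dt (x.1⁻¹ ^ x.2) (dn L).prod = dt (x.1 ^ x.2) (up L).prod := by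
      rw [dt_pow_left, dt_pow_left]; simp only [dt, dn_a, dn_b, Heis.inv_a, Heis.inv_b]; ring
    rw [h2, dt_pow_left]
    have h3 : (L.map fun y => (x.2 : ℝ) * y.2 * ad x.1 y.1).sum =
        x.2 * (L.map fun y => (y.2 : ℝ) * ad x.1 y.1).sum := by
      rw [← List.sum_map_mul_left]; simp only [mul_assoc]
    rw [h3, ← h1]
    push_cast; ring

lemma poly_prod (L : List (Heis × ℕ)) (h : L.Pairwise (fun x y => 0 ≤ dt x.1 y.1)) :
    ∃ N : ℤ, (up L ++ dn L).prod = Heis.z ^ N ∧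
      2 * (N : ℝ) = DS L (fun x y => (x.2 : ℝ) * y.2 * ad x.1 y.1) := by
  refine ⟨(up L ++ dn L).prod.c, ?_, ?_⟩
  · rw [z_zpow]; ext <;> simp [dn_a, dn_b]
  · rw [← sg_up_dn L h]
    have : sg ((up L).prod * (dn L).prod) = sg (up L).prod + sg (dn L).prod := by
      rw [sg_mul]; simp only [dt, dn_a, dn_b]; ring
    have h2 : sg ((up L).prod * (dn L).prod) = 2 * (up L ++ dn L).prod.c := by
      rw [← List.prod_append]
      simp only [sg]
      have : (up L ++ dn L).prod.a = 0 := by simp [dn_a]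
      rw [this]; ring
    rw [h2] at this
    exact_mod_cast this

lemma comm_z (p q : Heis) (r j : ℕ) :
    p⁻¹ ^ r * (q ^ j * p ^ r) = q ^ j * Heis.z ^ (-(r * j * dt p q) : ℤ) := by
  have : q ^ j * p ^ r = p ^ r * (q ^ j * Heis.z ^ (-(r * j * dt p q) : ℤ)) := by
    rw [z_zpow]
    ext
    · simp; ring
    · simp; ring
    · simp [pow_a, pow_b, dt]; ring
  rw [this, ← mul_assoc, inv_pow, inv_mul_cancel, one_mul]

lemma z_comm (g : Heis) (k : ℤ) : g * Heis.z ^ k = Heis.z ^ k * g := by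
  rw [z_zpow]; ext <;> simp; ring

lemma corner_trim (X Y : List Heis) (p q : Heis) (i j M : ℕ) (hi : M ≤ i) (hj : M ≤ j) :
    ∃ X' Y', X ++ (List.replicate i p ++ (List.replicate j q ++ Y)) =
      X' ++ (List.replicate M p ++ (List.replicate M q ++ Y')) := by
  refine ⟨X ++ List.replicate (i - M) p, List.replicate (j - M) q ++ Y, ?_⟩
  have e1 : List.replicate i p = List.replicate (i - M) p ++ List.replicate M p := by
    rw [List.replicate_append_replicate, Nat.sub_add_cancel hi]
  have e2 : List.replicate j q = List.replicate M q ++ List.replicate (j - M) q := by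
    rw [List.replicate_append_replicate, Nat.add_sub_cancel' hj]
  rw [e1, e2]; simp only [List.append_assoc]

lemma DS_mono {α : Type*} (w : List α) {F G : α → α → ℝ} (h : ∀ a ∈ w, ∀ b ∈ w, F a b ≤ G a b) :
    DS w F ≤ DS w G :=
  List.sum_le_sum fun a ha => List.sum_le_sum fun b hb => h a ha b hb

lemma DS_lin {α : Type*} (w : List α) (F G : α → α → ℝ) (s t : ℝ) :
    DS w (fun a b => s * F a b + t * G a b) = s * DS w F + t * DS w G := by
  simp only [DS, List.sum_map_add, List.sum_map_mul_left]

lemma DS_nonneg {α : Type*} (w : List α) {F : α → α → ℝ} (h : ∀ a b, 0 ≤ F a b) : 0 ≤ DS w F := by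
  apply List.sum_nonneg
  intro v hv
  obtain ⟨y, hy, rfl⟩ := List.mem_map.1 hv
  apply List.sum_nonneg
  intro v hv
  obtain ⟨y, hy, rfl⟩ := List.mem_map.1 hv
  exact h _ _

/-- rounding up a weighted list -/
noncomputable def rd (t : ℝ) (x : Heis × ℝ) : Heis × ℕ := (x.1, ⌈t * x.2⌉₊)

lemma rd_bounds (L : List (Heis × ℝ)) (hL : ∀ x ∈ L, 0 < x.2 ∧ x.2 ≤ 1) (t : ℝ) (ht : 1 ≤ t) :
    t ^ 2 * DS L wad ≤ DS (L.map (rd t)) (fun x y => (x.2 : ℝ) * y.2 * ad x.1 y.1) ∧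
    DS (L.map (rd t)) (fun x y => (x.2 : ℝ) * y.2 * ad x.1 y.1) ≤
      t ^ 2 * DS L wad + (3 * t) * DS L (fun x y => ad x.1 y.1) := by
  have e : DS (L.map (rd t)) (fun x y => (x.2 : ℝ) * y.2 * ad x.1 y.1) =
      DS L (fun x y => (⌈t * x.2⌉₊ : ℝ) * ⌈t * y.2⌉₊ * ad x.1 y.1) := by
    simp [DS, List.map_map, rd, Function.comp_def]
  rw [e]
  constructor
  · have := DS_lin L wad wad (t ^ 2) 0
    rw [zero_mul, add_zero] at this
    rw [← this]
    apply DS_mono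
    intro a ha b hb
    have h1 := Nat.le_ceil (t * a.2)
    have h2 := Nat.le_ceil (t * b.2)
    have ha := hL a ha
    have hb := hL b hb
    have ha0 : 0 ≤ t * a.2 := mul_nonneg (by linarith) ha.1.le
    have hb0 : 0 ≤ t * b.2 := mul_nonneg (by linarith) hb.1.le
    have h3 : (t * a.2) * (t * b.2) ≤ (⌈t * a.2⌉₊ : ℝ) * ⌈t * b.2⌉₊ :=
      mul_le_mul h1 h2 hb0 (by positivity)
    have := mul_le_mul_of_nonneg_right h3 (ad_nonneg a.1 b.1)
    simp only [wad]
    linarith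
  · rw [← DS_lin]
    apply DS_mono
    intro a ha b hb
    have ha := hL a ha
    have hb := hL b hb
    have ha0 : 0 ≤ t * a.2 := mul_nonneg (by linarith) ha.1.le
    have hb0 : 0 ≤ t * b.2 := mul_nonneg (by linarith) hb.1.le
    have h1 := (Nat.ceil_lt_add_one ha0).le
    have h2 := (Nat.ceil_lt_add_one hb0).le
    have h3 : (⌈t * a.2⌉₊ : ℝ) * ⌈t * b.2⌉₊ ≤ (t * a.2 + 1) * (t * b.2 + 1) :=
      mul_le_mul h1 h2 (by positivity) (by positivity)
    have h4 : (t * a.2 + 1) * (t * b.2 + 1) ≤ t ^ 2 * (a.2 * b.2) + 3 * t := by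
      have : t * a.2 ≤ t := by nlinarith
      have : t * b.2 ≤ t := by nlinarith
      nlinarith
    have := mul_le_mul_of_nonneg_right (h3.trans h4) (ad_nonneg a.1 b.1)
    simp only [wad]
    linarith

lemma rd_sum (L : List (Heis × ℝ)) (hL : ∀ x ∈ L, 0 < x.2 ∧ x.2 ≤ 1) (t : ℝ) (ht : 1 ≤ t) :
    ((((L.map (rd t)).map Prod.snd).sum : ℕ) : ℝ) ≤ t * (L.map Prod.snd).sum + L.length := by
  induction L with
  | nil => simp
  | cons x L ih =>
    have h1 := ih (fun y hy => hL y (List.mem_cons_of_mem _ hy))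
    have hx := hL x (List.mem_cons_self)
    have h2 := (Nat.ceil_lt_add_one (mul_nonneg (by linarith : 0 ≤ t) hx.1.le)).le
    simp only [List.map_cons, List.sum_cons, List.length_cons]
    rw [Nat.cast_add (rd t x).2, Nat.cast_add L.length, Nat.cast_one]
    have h3 : ((rd t x).2 : ℝ) = ⌈t * x.2⌉₊ := rfl
    linarith

lemma exists_min_word (A : Finset Heis) (g : Heis) (w : List Heis) (hw : IsWordOn A w)
    (hg : w.prod = g) : ∃ w', IsWordOn A w' ∧ w'.length = wlen A g ∧ w'.prod = g := by
  have : (wlen A g) ∈ {n | ∃ w : List Heis, IsWordOn A w ∧ w.length = n ∧ w.prod = g} :=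
    Nat.sInf_mem ⟨w.length, w, hw, rfl, hg⟩
  exact this

lemma wlen_le (A : Finset Heis) (g : Heis) (w : List Heis) (hw : IsWordOn A w)
    (hg : w.prod = g) : wlen A g ≤ w.length :=
  Nat.sInf_le ⟨w, hw, rfl, hg⟩

lemma exists_dt_ne (A : Finset Heis) (hA : IsGenSet A) : ∃ a ∈ A, ∃ b ∈ A, dt a b ≠ 0 := by
  by_contra hcon
  push Not at hcon
  have h1 : ∀ a ∈ A, ∀ g : Heis, dt a g = 0 := by
    intro a ha g
    have hg : g ∈ Subgroup.closure (A : Set Heis) := by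
      rw [show Subgroup.closure (A : Set Heis) = ⊤ from hA]; trivial
    induction hg using Subgroup.closure_induction with
    | mem b hb => exact hcon a ha b hb
    | one => exact dt_one_right a
    | mul x y _ _ hx hy => rw [dt_mul_right, hx, hy]; rfl
    | inv x _ hx => rw [dt_inv_right, hx]; rfl
  have h2 : ∀ g h : Heis, dt g h = 0 := by
    intro g h
    have hg : g ∈ Subgroup.closure (A : Set Heis) := by
      rw [show Subgroup.closure (A : Set Heis) = ⊤ from hA]; trivial
    induction hg using Subgroup.closure_induction with
    | mem b hb => exact h1 b hb h
    | one => exact dt_one_left h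
    | mul x y _ _ hx hy => rw [dt_mul_left, hx, hy]; rfl
    | inv x _ hx => rw [dt_inv_left, hx]; rfl
  have := h2 Heis.x Heis.y
  simp [dt, Heis.x, Heis.y] at this

lemma central_move (a b c d e f : Heis) (k : ℤ) :
    a * (b * (c * ((d * Heis.z ^ k) * (e * f)))) =
      Heis.z ^ k * (a * (b * ((c * d) * e)) * f) := by
  rw [z_zpow]; ext <;> simp <;> ring

set_option maxHeartbeats 1000000 in
/-- Near-geodesic polygonal words with two opposite deep corners. -/
theorem core (A : Finset Heis) (hA : IsGenSet A) :
    ∃ p q : Heis, (p ∈ A ∨ p⁻¹ ∈ A) ∧ (q ∈ A ∨ q⁻¹ ∈ A) ∧ 0 < dt p q ∧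
    ∃ (C D : ℕ) (δ : ℝ) (N₀ : ℕ), 0 < δ ∧ ∀ n : ℤ, (N₀ : ℤ) ≤ n → ∃ (n' : ℤ) (W : List Heis),
      |n - n'| ≤ C ∧ IsWordOn A W ∧ W.prod = Heis.z ^ n' ∧
      W.length ≤ wlen A (Heis.z ^ n') + D ∧
      ∀ M : ℕ, (M : ℝ) ≤ δ * √n →
        (∃ X Y, W = X ++ (List.replicate M p ++ (List.replicate M q ++ Y))) ∧
        (∃ X Y, W = X ++ (List.replicate M p⁻¹ ++ (List.replicate M q⁻¹ ++ Y))) := by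
  classical
  set S : Finset Heis := A ∪ A.image (fun a => a⁻¹) with hSdef
  have hS : ∀ a, a ∈ S ↔ (a ∈ A ∨ a⁻¹ ∈ A) := by
    intro a
    simp only [hSdef, Finset.mem_union, Finset.mem_image]
    constructor
    · rintro (h | ⟨b, hb, rfl⟩)
      · exact Or.inl h
      · right; simpa using hb
    · rintro (h | h)
      · exact Or.inl h
      · exact Or.inr ⟨_, h, inv_inv a⟩
  have hinv : ∀ a ∈ S, a⁻¹ ∈ S := by
    intro a ha
    rw [hS] at ha ⊢
    rw [inv_inv]; exact ha.symm
  obtain ⟨a₀, ha₀, b₀, hb₀, hab⟩ := exists_dt_ne A hA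
  obtain ⟨κ, hκ0, hκ1, hmax⟩ := exists_max S ⟨a₀, (hS a₀).2 (Or.inl ha₀)⟩ ad
  obtain ⟨L, hL, hLs, hLc, hLp⟩ := exists_list S hinv κ hκ0 hκ1
  rw [← hLc] at hmax
  set c := DS L wad with hc_def
  have hc : 0 < c := by
    have h1 := hmax [a₀, b₀] (by
      intro a ha
      simp only [List.mem_cons, List.not_mem_nil, or_false] at ha
      rcases ha with rfl | rfl
      · exact (hS _).2 (Or.inl ha₀)
      · exact (hS _).2 (Or.inl hb₀))
    have h2 : 0 < ad a₀ b₀ := by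
      unfold ad; apply abs_pos.2; exact_mod_cast hab
    have h3 := ad_symm a₀ b₀
    simp [DS, ad_self] at h1
    rw [← h3] at h1
    nlinarith
  obtain ⟨L₁, p, q, L₂, hLsplit, hd⟩ := exists_corner L (fun x hx => (hL x hx).2.2.2) hLp hc.ne'
  have hpL : p ∈ L := by simp [hLsplit]
  have hqL : q ∈ L := by simp [hLsplit]
  obtain ⟨hpS, hp0, hp1, -⟩ := hL p hpL
  obtain ⟨hqS, hq0, hq1, -⟩ := hL q hqL
  -- constants
  obtain ⟨K, hK⟩ : ∃ K : ℝ, ∀ a ∈ S, |(sg a : ℝ)| ≤ K :=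
    ⟨∑ a ∈ S, |(sg a : ℝ)|, fun a ha =>
      Finset.single_le_sum (f := fun a => |(sg a : ℝ)|) (fun b _ => abs_nonneg _) ha⟩
  have hK0 : 0 ≤ K := (abs_nonneg _).trans (hK _ hpS)
  set Λ := 3 * DS L (fun x y => ad x.1 y.1) with hΛ
  obtain ⟨r, hr⟩ : ∃ r : ℕ, Λ / q.2 + 1 ≤ r := exists_nat_ge _
  have hΛ0 : 0 ≤ Λ := mul_nonneg (by norm_num) (DS_nonneg _ fun a b => ad_nonneg _ _)
  have hr1 : (1 : ℝ) ≤ r := by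
    have : 0 ≤ Λ / q.2 := by positivity
    linarith
  have hrΛ : Λ ≤ r * q.2 := by
    have : Λ / q.2 ≤ r := by linarith
    rwa [div_le_iff₀ hq0] at this
  set d := dt p.1 q.1 with hd_def
  obtain ⟨D, hD⟩ : ∃ D : ℕ, (2 * K / c + 1) + 2 * L.length + 2 * r ≤ D := exists_nat_ge _
  obtain ⟨N₀, hN₀⟩ : ∃ N : ℕ, c / 2 + 1 ≤ N := exists_nat_ge _
  set δ := min p.2 (q.2 / 2) * √(2 / c) with hδ
  have hδ0 : 0 < δ := mul_pos (lt_min hp0 (by positivity)) (by positivity)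
  have hL01 : ∀ x ∈ L, 0 < x.2 ∧ x.2 ≤ 1 := fun x hx => ⟨(hL x hx).2.1, (hL x hx).2.2.1⟩
  refine ⟨p.1, q.1, (hS _).1 hpS, (hS _).1 hqS, hd, (r * d).toNat, D, δ, N₀, hδ0, ?_⟩
  intro n hn
  have hnR : c / 2 + 1 ≤ (n : ℝ) := hN₀.trans (by exact_mod_cast hn)
  set t := √(2 * n / c) with ht_def
  have ht2 : t ^ 2 = 2 * n / c := Real.sq_sqrt (by apply div_nonneg _ hc.le; linarith)
  have ht1 : 1 ≤ t := by
    apply Real.one_le_sqrt.2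
    rw [le_div_iff₀ hc]; linarith
  obtain ⟨hR1, hR2⟩ := rd_bounds L hL01 t ht1
  have hRs := rd_sum L hL01 t ht1
  have hpw : (L.map (rd t)).Pairwise (fun x y => 0 ≤ dt x.1 y.1) := by
    rw [List.pairwise_map]
    exact hLp.imp_of_mem fun ha hb h =>
      dt_of_key_le (hL _ ha).2.2.2 (hL _ hb).2.2.2 h
  obtain ⟨N, hN, hN2⟩ := poly_prod _ hpw
  rw [← hN2] at hR1 hR2
  have hc2 : t ^ 2 * c = 2 * n := by rw [ht2]; field_simp
  rw [← hc_def, hc2] at hR1 hR2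
  have hNn : n ≤ N := by
    have : (n : ℝ) ≤ N := by linarith
    exact_mod_cast this
  have hrd : (0 : ℤ) < r * d := by
    have : (0 : ℤ) < r := by
      have : (0 : ℝ) < r := by linarith
      exact_mod_cast this
    positivity
  set j : ℕ := ((N - n) / (r * d)).toNat with hj_def
  have hj : (j : ℤ) = (N - n) / (r * d) :=
    Int.toNat_of_nonneg (Int.ediv_nonneg (by linarith) hrd.le)
  have hj1 : (r * d) * j ≤ N - n := by rw [hj]; exact Int.mul_ediv_self_le hrd.ne'
  have hj2 : N - n < (r * d) * j + r * d := by
    rw [hj]; exact Int.lt_mul_ediv_self_add hrd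
  set kp : ℕ := ⌈t * p.2⌉₊ with hkp
  set kq : ℕ := ⌈t * q.2⌉₊ with hkq
  have hkp1 : t * p.2 ≤ kp := Nat.le_ceil _
  have hkq1 : t * q.2 ≤ kq := Nat.le_ceil _
  have hjR : (j : ℝ) ≤ t * q.2 / 2 := by
    have h1 : ((r * d : ℤ) : ℝ) * j ≤ N - n := by exact_mod_cast hj1
    have h2 : (r : ℝ) ≤ ((r * d : ℤ) : ℝ) := by
      push_cast
      have : (1 : ℝ) ≤ d := by exact_mod_cast hd
      nlinarith
    have h3 : (r : ℝ) * j ≤ ((r * d : ℤ) : ℝ) * j := by gcongr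
    have h4 : (r : ℝ) * j ≤ r * (t * q.2 / 2) := by
      have : t * Λ ≤ t * (r * q.2) := by gcongr
      have e : 3 * t * DS L (fun x y => ad x.1 y.1) = t * Λ := by rw [hΛ]; ring
      rw [e] at hR2
      linarith
    exact le_of_mul_le_mul_left h4 (by linarith)
  have hjk : j ≤ kq := by
    have : (j : ℝ) ≤ kq := by
      have : 0 ≤ t * q.2 := mul_nonneg (by linarith) hq0.le
      linarith
    exact_mod_cast this
  set U₁ := up (L₁.map (rd t)) with hU1
  set U₂ := up (L₂.map (rd t)) with hU2
  set V₁ := dn (L₁.map (rd t)) with hV1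
  set V₂ := dn (L₂.map (rd t)) with hV2
  have hup : up (L.map (rd t)) = U₁ ++ (List.replicate kp p.1 ++ (List.replicate kq q.1 ++ U₂)) := by
    rw [hLsplit, List.map_append, List.map_cons, List.map_cons, up_append, up_cons, up_cons]
    rfl
  have hdn : dn (L.map (rd t)) =
      V₁ ++ (List.replicate kp p.1⁻¹ ++ (List.replicate kq q.1⁻¹ ++ V₂)) := by
    rw [hLsplit, List.map_append, List.map_cons, List.map_cons, dn_append, dn_cons, dn_cons]
    rfl
  have hupS : ∀ a ∈ up (L.map (rd t)), a ∈ S := by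
    intro a ha
    simp only [up, List.mem_flatMap, List.mem_map] at ha
    obtain ⟨_, ⟨x, hx, rfl⟩, ha⟩ := ha
    rw [List.eq_of_mem_replicate ha]
    exact (hL x hx).1
  have hdnS : ∀ a ∈ dn (L.map (rd t)), a ∈ S := by
    intro a ha
    simp only [dn, List.mem_flatMap, List.mem_map] at ha
    obtain ⟨_, ⟨x, hx, rfl⟩, ha⟩ := ha
    rw [List.eq_of_mem_replicate ha]
    exact hinv _ (hL x hx).1
  set W : List Heis := U₁ ++ (List.replicate kp p.1 ++ (List.replicate (kq - j) q.1 ++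
    (List.replicate r p.1⁻¹ ++ (List.replicate j q.1 ++ (List.replicate r p.1 ++
      (U₂ ++ dn (L.map (rd t)))))))) with hW
  have hWS : ∀ a ∈ W, a ∈ S := by
    intro a ha
    simp only [hW, List.mem_append] at ha
    rw [hup] at hupS
    simp only [List.mem_append] at hupS
    rcases ha with h | h | h | h | h | h | h | h
    · exact hupS a (by tauto)
    · rw [List.eq_of_mem_replicate h]; exact hpS
    · rw [List.eq_of_mem_replicate h]; exact hqS
    · rw [List.eq_of_mem_replicate h]; exact hinv _ hpS
    · rw [List.eq_of_mem_replicate h]; exact hqS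
    · rw [List.eq_of_mem_replicate h]; exact hpS
    · exact hupS a (by tauto)
    · exact hdnS a h
  have hWord : ∀ w : List Heis, (∀ a ∈ w, a ∈ S) ↔ IsWordOn A w := by
    intro w; unfold IsWordOn; simp only [hS]
  have hWprod : W.prod = Heis.z ^ (N - r * j * d) := by
    rw [hup] at hN
    simp only [hW, List.prod_append, List.prod_replicate] at hN ⊢
    have e1 : p.1⁻¹ ^ r * (q.1 ^ j * (p.1 ^ r * (U₂.prod * (dn (L.map (rd t))).prod))) =
        (q.1 ^ j * Heis.z ^ (-(r * j * d) : ℤ)) * (U₂.prod * (dn (L.map (rd t))).prod) := by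
      rw [← comm_z]; group
    have e2 : q.1 ^ kq = q.1 ^ (kq - j) * q.1 ^ j := by
      rw [← pow_add, Nat.sub_add_cancel hjk]
    rw [e1, sub_eq_add_neg, add_comm, zpow_add, ← hN, e2, central_move]
  have hj3 : (r * j * d : ℤ) = r * d * j := by ring
  have hn'1 : |n - (N - r * j * d)| ≤ ((r * d).toNat : ℤ) := by
    rw [Int.toNat_of_nonneg hrd.le, abs_le]
    constructor <;> linarith
  refine ⟨N - r * j * d, W, hn'1, (hWord W).1 hWS, hWprod, ?_, ?_⟩
  · obtain ⟨w', hw', hl', hp'⟩ := exists_min_word A _ W ((hWord W).1 hWS) hWprod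
    have hlow := lower_bound S c K hc hK0 hK hmax w' ((hWord w').2 hw') _ hp'
    rw [hl'] at hlow
    have hlen : (W.length : ℝ) ≤ 2 * t + 2 * L.length + 2 * r := by
      have l1 : W.length = (up (L.map (rd t))).length + (dn (L.map (rd t))).length + 2 * r := by
        rw [hup]
        simp only [hW, List.length_append, List.length_replicate]
        omega
      rw [l1, up_length, dn_length]
      push_cast [-Nat.cast_list_sum]
      have : t * (L.map Prod.snd).sum ≤ t := mul_le_of_le_one_right (by linarith) hLs
      linarith
    have ht3 : 2 * t ≤ √(8 * ((N - r * j * d : ℤ) : ℝ) / c) := by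
      apply Real.le_sqrt_of_sq_le
      have : (2 * t) ^ 2 = 8 * n / c := by rw [mul_pow, ht2]; ring
      rw [this]
      have : (n : ℝ) ≤ ((N - r * j * d : ℤ) : ℝ) := by
        have : n ≤ N - r * j * d   := by linarith
        exact_mod_cast this
      gcongr
    have : (W.length : ℝ) ≤ wlen A (Heis.z ^ (N - r * j * d)) + D := by linarith
    exact_mod_cast this
  · intro M hM
    have hM2 : (M : ℝ) ≤ min p.2 (q.2 / 2) * t := by
      have : √(2 / c) * √n = t := by
        rw [← Real.sqrt_mul (by positivity), ht_def]; congr 1; ring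
      rw [hδ, mul_assoc, this] at hM
      exact hM
    have hMp : (M : ℝ) ≤ t * p.2 := by
      have : min p.2 (q.2 / 2) * t ≤ p.2 * t := by
        gcongr; exact min_le_left _ _
      linarith
    have hMq : (M : ℝ) ≤ t * q.2 / 2 := by
      have : min p.2 (q.2 / 2) * t ≤ (q.2 / 2) * t := by
        gcongr; exact min_le_right _ _
      linarith
    have a1 : M ≤ kp := by exact_mod_cast hMp.trans hkp1
    have a2 : M ≤ kq - j := by
      have : (M : ℝ) + j ≤ kq := by linarith
      have : M + j ≤ kq := by exact_mod_cast this
      omega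
    have a3 : M ≤ kq := a2.trans (Nat.sub_le _ _)
    constructor
    · exact corner_trim _ _ _ _ _ _ _ a1 a2
    · have e : W = (U₁ ++ (List.replicate kp p.1 ++ (List.replicate (kq - j) q.1 ++
          (List.replicate r p.1⁻¹ ++ (List.replicate j q.1 ++ (List.replicate r p.1 ++
          (U₂ ++ V₁))))))) ++ (List.replicate kp p.1⁻¹ ++ (List.replicate kq q.1⁻¹ ++ V₂)) := by
        rw [hW, hdn]; simp only [List.append_assoc]
      rw [e]
      exact corner_trim _ _ _ _ _ _ _ a1 a3

lemma isWordOn_append {A : Finset Heis} {u v : List Heis} :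
    IsWordOn A (u ++ v) ↔ IsWordOn A u ∧ IsWordOn A v := by
  unfold IsWordOn
  simp only [List.mem_append, or_imp, forall_and]

lemma isWordOn_replicate {A : Finset Heis} {p : Heis} (hp : p ∈ A ∨ p⁻¹ ∈ A) (k : ℕ) :
    IsWordOn A (List.replicate k p) := by
  intro a ha; rw [List.eq_of_mem_replicate ha]; exact hp

/-- formal inverse of a word -/
def winv (w : List Heis) : List Heis := (w.map (fun a => a⁻¹)).reverse

lemma winv_prod (w : List Heis) : (winv w).prod = w.prod⁻¹ := (List.prod_inv_reverse w).symm

lemma winv_length (w : List Heis) : (winv w).length = w.length := by simp [winv]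

lemma winv_isWordOn {A : Finset Heis} {w : List Heis} (h : IsWordOn A w) : IsWordOn A (winv w) := by
  intro a ha
  simp only [winv, List.mem_reverse, List.mem_map] at ha
  obtain ⟨b, hb, rfl⟩ := ha
  rw [inv_inv]; exact (h b hb).symm

lemma winv_corner (X Y : List Heis) (p q : Heis) (M : ℕ) :
    winv (X ++ (List.replicate M p ++ (List.replicate M q ++ Y))) =
      winv Y ++ (List.replicate M q⁻¹ ++ (List.replicate M p⁻¹ ++ winv X)) := by
  simp [winv]

lemma exists_word (A : Finset Heis) (hA : IsGenSet A) (g : Heis) :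
    ∃ w, IsWordOn A w ∧ w.prod = g := by
  have hg : g ∈ Subgroup.closure (A : Set Heis) := by
    rw [show Subgroup.closure (A : Set Heis) = ⊤ from hA]; trivial
  induction hg using Subgroup.closure_induction with
  | mem b hb => exact ⟨[b], by intro a ha; simp at ha; subst ha; exact Or.inl hb, by simp⟩
  | one => exact ⟨[], by intro a ha; simp at ha, rfl⟩
  | mul x y _ _ hx hy =>
    obtain ⟨u, hu, rfl⟩ := hx
    obtain ⟨v, hv, rfl⟩ := hy
    exact ⟨u ++ v, isWordOn_append.2 ⟨hu, hv⟩, by simp⟩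
  | inv x _ hx =>
    obtain ⟨u, hu, rfl⟩ := hx
    exact ⟨winv u, winv_isWordOn hu, winv_prod u⟩

lemma wlen_inv_le (A : Finset Heis) (hA : IsGenSet A) (g : Heis) : wlen A g⁻¹ ≤ wlen A g := by
  obtain ⟨w, hw, hg⟩ := exists_word A hA g
  obtain ⟨w', hw', hl, hp⟩ := exists_min_word A g w hw hg
  rw [← hl, ← winv_length w']
  exact wlen_le A _ _ (winv_isWordOn hw') (by rw [winv_prod, hp])

lemma abs_ediv_le (x d : ℤ) (hd : 0 < d) : |x / d| ≤ |x| := by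
  rcases le_total 0 x with h | h
  · rw [abs_of_nonneg h, abs_of_nonneg (Int.ediv_nonneg h hd.le)]
    exact Int.ediv_le_self d h
  · have h2 : x / d ≤ 0 := by
      have := Int.ediv_le_ediv hd h
      simpa using this
    have h3 : x ≤ x / d := by
      rw [Int.le_ediv_iff_mul_le hd]; nlinarith
    rw [abs_of_nonpos h, abs_of_nonpos h2]; linarith

lemma rem_bound (d r s a b f : ℤ) (hd : 0 < d) (hr : 0 ≤ r) (hr' : r < d) (hs : 0 ≤ s)
    (hs' : s < d) (h : d * f = r * a + s * b) : |f| ≤ |a| + |b| := by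
  have h1 : d * |f| ≤ d * (|a| + |b|) := by
    calc d * |f| = |r * a + s * b| := by rw [← h, abs_mul, abs_of_pos hd]
      _ ≤ |r * a| + |s * b| := abs_add_le _ _
      _ = r * |a| + s * |b| := by rw [abs_mul, abs_mul, abs_of_nonneg hr, abs_of_nonneg hs]
      _ ≤ d * |a| + d * |b| := by
        have := abs_nonneg a
        have := abs_nonneg b
        gcongr
      _ = _ := by ring
  exact le_of_mul_le_mul_left h1 hd

lemma dec (A : Finset Heis) (hA : IsGenSet A) (p q : Heis) (hd : 0 < dt p q) :
    ∃ K E : ℕ, ∀ v : ℤ × ℤ, dt ⟨v.1, v.2, 0⟩ q + dt p ⟨v.1, v.2, 0⟩ ≤ 0 →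
      ∃ (α β : ℤ) (f : List Heis), IsWordOn A f ∧ f.length ≤ E ∧
        |α| ≤ K * (|v.1| + |v.2|) ∧ |β| ≤ K * (|v.1| + |v.2|) ∧ α + β ≤ 0 ∧
        v.1 = α * p.a + β * q.a + f.prod.a ∧ v.2 = α * p.b + β * q.b + f.prod.b := by
  choose wd hwd hwdp using fun f : ℤ × ℤ => exists_word A hA ⟨f.1, f.2, 0⟩
  set B : ℤ := |p.a| + |p.b| + |q.a| + |q.b| with hB
  have n1 := abs_nonneg p.a
  have n2 := abs_nonneg p.b
  have n3 := abs_nonneg q.a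
  have n4 := abs_nonneg q.b
  refine ⟨B.toNat, ∑ f ∈ Finset.Icc (-B) B ×ˢ Finset.Icc (-B) B, (wd f).length, ?_⟩
  intro v hv
  rw [Int.toNat_of_nonneg (by positivity)]
  set d := dt p q with hd_def
  set x := dt ⟨v.1, v.2, 0⟩ q with hx
  set y := dt p ⟨v.1, v.2, 0⟩ with hy
  have m1 := Int.emod_nonneg x hd.ne'
  have m2 := Int.emod_lt_of_pos x hd
  have m3 := Int.emod_nonneg y hd.ne'
  have m4 := Int.emod_lt_of_pos y hd
  have e1 : d * (x / d) = x - x % d := by have := Int.mul_ediv_add_emod x d; linarith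
  have e2 : d * (y / d) = y - y % d := by have := Int.mul_ediv_add_emod y d; linarith
  have v1 := abs_nonneg v.1
  have v2 := abs_nonneg v.2
  have hf1 : |v.1 - (x / d) * p.a - (y / d) * q.a| ≤ |p.a| + |q.a| := by
    apply rem_bound d (x % d) (y % d) _ _ _ hd m1 m2 m3 m4
    have : d * v.1 = x * p.a + y * q.a := by simp only [hx, hy, hd_def, dt]; ring
    linear_combination this - p.a * e1 - q.a * e2
  have hf2 : |v.2 - (x / d) * p.b - (y / d) * q.b| ≤ |p.b| + |q.b| := by
    apply rem_bound d (x % d) (y % d) _ _ _ hd m1 m2 m3 m4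
    have : d * v.2 = x * p.b + y * q.b := by simp only [hx, hy, hd_def, dt]; ring
    linear_combination this - p.b * e1 - q.b * e2
  refine ⟨x / d, y / d, wd (v.1 - (x / d) * p.a - (y / d) * q.a,
    v.2 - (x / d) * p.b - (y / d) * q.b), hwd _, ?_, ?_, ?_, ?_, ?_, ?_⟩
  · apply Finset.single_le_sum (f := fun f => (wd f).length) (fun _ _ => Nat.zero_le _)
    rw [Finset.mem_product, Finset.mem_Icc, Finset.mem_Icc, ← abs_le, ← abs_le]
    constructor
    · exact hf1.trans (by linarith)
    · exact hf2.trans (by linarith)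
  · refine (abs_ediv_le x d hd).trans ?_
    have : |x| ≤ |v.1| * |q.b| + |q.a| * |v.2| := by
      rw [hx, ← abs_mul, ← abs_mul]; exact abs_sub _ _
    nlinarith
  · refine (abs_ediv_le y d hd).trans ?_
    have : |y| ≤ |p.a| * |v.2| + |v.1| * |p.b| := by
      rw [hy, ← abs_mul, ← abs_mul]; exact abs_sub _ _
    nlinarith
  · have : d * (x / d + y / d) ≤ 0 := by rw [mul_add, e1, e2]; linarith
    by_contra hcon
    push Not at hcon
    have := mul_pos hd hcon
    linarith
  · rw [hwdp]; ring
  · rw [hwdp]; ring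

lemma finish (A : Finset Heis) (W : List Heis) (n' : ℤ) (hW : IsWordOn A W)
    (hWp : W.prod = Heis.z ^ n') (p q : Heis) (hp : p ∈ A ∨ p⁻¹ ∈ A) (hq : q ∈ A ∨ q⁻¹ ∈ A)
    (M : ℕ) (hc : ∃ X Y, W = X ++ (List.replicate M p ++ (List.replicate M q ++ Y)))
    (v : ℤ × ℤ) (α β : ℤ) (f : List Heis) (hf : IsWordOn A f) (E : ℕ) (hfE : f.length ≤ E)
    (hα : |α| ≤ M) (hβ : |β| ≤ M) (hαβ : α + β ≤ 0)
    (hv1 : v.1 = α * p.a + β * q.a + f.prod.a) (hv2 : v.2 = α * p.b + β * q.b + f.prod.b) :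
    ∃ w w' : List Heis, IsWordOn A w ∧ IsWordOn A w' ∧ w.prod = Heis.z ^ n' ∧
      w.length = W.length ∧ Heis.φ w'.prod = v ∧ w'.length ≤ w.length + E ∧
      ∃ u u' w₂ : List Heis, w = u ++ w₂ ∧ w' = u' ++ w₂ ∧ u.length + u'.length ≤ 4 * M + E := by
  obtain ⟨X, Y, rfl⟩ := hc
  rw [abs_le] at hα hβ
  obtain ⟨i, hi⟩ := Int.eq_ofNat_of_zero_le (show 0 ≤ (M : ℤ) + α by linarith)
  obtain ⟨j, hj⟩ := Int.eq_ofNat_of_zero_le (show 0 ≤ (M : ℤ) + β by linarith)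
  simp only [isWordOn_append] at hW
  obtain ⟨hX, hP, hQ, hY⟩ := hW
  have hprod : ((List.replicate M p ++ List.replicate M q) ++ (Y ++ X)).prod = Heis.z ^ n' := by
    simp only [List.prod_append] at hWp ⊢
    have : (List.replicate M p).prod * (List.replicate M q).prod * (Y.prod * X.prod) =
        X.prod⁻¹ * (X.prod * ((List.replicate M p).prod * ((List.replicate M q).prod * Y.prod)))
          * X.prod := by group
    rw [this, hWp, mul_assoc, ← z_comm]; group
  refine ⟨(List.replicate M p ++ List.replicate M q) ++ (Y ++ X),
    (List.replicate i p ++ List.replicate j q ++ f) ++ (Y ++ X), ?_, ?_, hprod, ?_, ?_, ?_,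
    _, _, _, rfl, rfl, ?_⟩
  · simp only [isWordOn_append]; tauto
  · simp only [isWordOn_append]
    exact ⟨⟨⟨isWordOn_replicate hp _, isWordOn_replicate hq _⟩, hf⟩, hY, hX⟩
  · simp only [List.length_append]; omega
  · rw [z_zpow] at hprod
    have ea := congrArg Heis.a hprod
    have eb := congrArg Heis.b hprod
    simp only [List.prod_append, Heis.mul_a, Heis.mul_b, List.prod_replicate, pow_a, pow_b] at ea eb
    have hi' : (i : ℤ) = M + α := hi.symm
    have hj' : (j : ℤ) = M + β := hj.symm
    ext
    · simp only [Heis.φ, List.prod_append, Heis.mul_a, List.prod_replicate, pow_a]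
      rw [hi', hj', hv1]; linarith
    · simp only [Heis.φ, List.prod_append, Heis.mul_b, List.prod_replicate, pow_b]
      rw [hi', hj', hv2]; linarith
  · simp only [List.length_append, List.length_replicate]; omega
  · simp only [List.length_append, List.length_replicate]; omega

lemma analytic (K E C : ℕ) (δ : ℝ) (hδ : 0 < δ) (N₀ : ℕ) :
    ∃ N : ℕ, N₀ ≤ N ∧ ∀ x : ℝ, (N : ℝ) ≤ x →
      (K : ℝ) * x ^ ((1 : ℝ) / 6) ≤ δ * √x ∧
      ∀ y : ℝ, x - C ≤ y → 4 * (K * x ^ ((1 : ℝ) / 6)) + E ≤ y ^ ((1 : ℝ) / 5) := by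
  have t1 : Filter.Tendsto (fun x : ℝ => x ^ ((1 : ℝ) / 3)) Filter.atTop Filter.atTop :=
    tendsto_rpow_atTop (by norm_num)
  have t2 : Filter.Tendsto (fun x : ℝ => x ^ ((1 : ℝ) / 30)) Filter.atTop Filter.atTop :=
    tendsto_rpow_atTop (by norm_num)
  obtain ⟨N₁, h₁⟩ := Filter.eventually_atTop.1 (t1.eventually_ge_atTop (K / δ))
  obtain ⟨N₂, h₂⟩ := Filter.eventually_atTop.1 (t2.eventually_ge_atTop (2 * (4 * K + E)))
  obtain ⟨N, hN⟩ := exists_nat_ge (|N₁| + |N₂| + 1 + 2 * C + N₀)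
  have a1 := abs_nonneg N₁
  have a2 := abs_nonneg N₂
  have a3 := le_abs_self N₁
  have a4 := le_abs_self N₂
  have hC : (0 : ℝ) ≤ C := by positivity
  have hN0 : (0 : ℝ) ≤ N₀ := by positivity
  refine ⟨N, ?_, ?_⟩
  · have : (N₀ : ℝ) ≤ N := by linarith
    exact_mod_cast this
  intro x hx
  have hx1 : 1 ≤ x := by linarith
  have hx0 : 0 < x := by linarith
  have b1 := h₁ x (by linarith)
  have b2 := h₂ x (by linarith)
  have hz : 1 ≤ x ^ ((1 : ℝ) / 6) := Real.one_le_rpow hx1 (by norm_num)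
  constructor
  · rw [div_le_iff₀ hδ] at b1
    have e : √x = x ^ ((1 : ℝ) / 3) * x ^ ((1 : ℝ) / 6) := by
      rw [← Real.rpow_add hx0, Real.sqrt_eq_rpow]; norm_num
    rw [e]
    have := mul_le_mul_of_nonneg_right b1 (by linarith : 0 ≤ x ^ ((1 : ℝ) / 6))
    linarith
  · intro y hy
    have hy2 : x / 2 ≤ y := by linarith
    have c1 : (x / 2) ^ ((1 : ℝ) / 5) ≤ y ^ ((1 : ℝ) / 5) :=
      Real.rpow_le_rpow (by positivity) hy2 (by norm_num)
    have c2 : x ^ ((1 : ℝ) / 5) / 2 ≤ (x / 2) ^ ((1 : ℝ) / 5) := by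
      rw [Real.div_rpow hx0.le (by norm_num)]
      have : (2 : ℝ) ^ ((1 : ℝ) / 5) ≤ 2 ^ (1 : ℝ) :=
        Real.rpow_le_rpow_of_exponent_le (by norm_num) (by norm_num)
      rw [Real.rpow_one] at this
      gcongr
    have e : x ^ ((1 : ℝ) / 5) = x ^ ((1 : ℝ) / 30) * x ^ ((1 : ℝ) / 6) := by
      rw [← Real.rpow_add hx0]; norm_num
    have := mul_le_mul_of_nonneg_right b2 (by linarith : 0 ≤ x ^ ((1 : ℝ) / 6))
    have hE : (E : ℝ) ≤ E * x ^ ((1 : ℝ) / 6) := le_mul_of_one_le_right (by positivity) hz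
    nlinarith

/-- The conclusion of the theorem for a given `n'` and `v`. -/
def Concl (A : Finset Heis) (D E n' : ℤ) (v : ℤ × ℤ) : Prop :=
  ∃ w w' : List Heis,
          IsWordOn A w ∧ IsWordOn A w' ∧
          w.prod = Heis.z ^ n' ∧
          (w.length : ℤ) ≤ (wlen A (Heis.z ^ n') : ℤ) + D ∧
          Heis.φ w'.prod = v ∧
          (w'.length : ℤ) - E ≤ (w.length : ℤ) ∧
          ∃ u u' w₂ : List Heis, w = u ++ w₂ ∧ w' = u' ++ w₂ ∧
            ((u.length + u'.length : ℕ) : ℝ) ≤ ((|n'| : ℤ) : ℝ) ^ ((1 : ℝ) / 5)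

lemma finish' (A : Finset Heis) (W : List Heis) (n' : ℤ) (hW : IsWordOn A W)
    (hWp : W.prod = Heis.z ^ n') (D : ℕ) (hD : W.length ≤ wlen A (Heis.z ^ n') + D)
    (p q : Heis) (hp : p ∈ A ∨ p⁻¹ ∈ A) (hq : q ∈ A ∨ q⁻¹ ∈ A)
    (M : ℕ) (hc : ∃ X Y, W = X ++ (List.replicate M p ++ (List.replicate M q ++ Y)))
    (v : ℤ × ℤ) (α β : ℤ) (f : List Heis) (hf : IsWordOn A f) (E : ℕ) (hfE : f.length ≤ E)
    (hα : |α| ≤ M) (hβ : |β| ≤ M) (hαβ : α + β ≤ 0)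
    (hv1 : v.1 = α * p.a + β * q.a + f.prod.a) (hv2 : v.2 = α * p.b + β * q.b + f.prod.b)
    (hM : 4 * (M : ℝ) + E ≤ ((|n'| : ℤ) : ℝ) ^ ((1 : ℝ) / 5)) :
    Concl A D E n' v := by
  obtain ⟨w, w', h1, h2, h3, h4, h5, h6, u, u', w₂, h7, h8, h9⟩ :=
    finish A W n' hW hWp p q hp hq M hc v α β f hf E hfE hα hβ hαβ hv1 hv2
  refine ⟨w, w', h1, h2, h3, ?_, h5, ?_, u, u', w₂, h7, h8, ?_⟩
  · rw [h4]; exact_mod_cast hD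
  · have : (w'.length : ℤ) ≤ w.length + E := by exact_mod_cast h6
    linarith
  · refine le_trans ?_ hM
    exact_mod_cast h9

lemma large (A : Finset Heis) (hA : IsGenSet A) :
    ∃ C D E N : ℕ, ∀ n : ℤ, (N : ℤ) ≤ n → ∃ n' : ℤ, |n - n'| ≤ C ∧
      ∀ v : ℤ × ℤ, ((|v.1| + |v.2| : ℤ) : ℝ) ≤ (n : ℝ) ^ ((1 : ℝ) / 6) →
        Concl A D E n' v ∧ Concl A D E (-n') v := by
  obtain ⟨p, q, hp, hq, hd, C, D, δ, N₀, hδ, hcore⟩ := core A hA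
  have hd' : 0 < dt p⁻¹ q⁻¹ := by rw [dt_inv_left, dt_inv_right]; linarith
  have hp' : p⁻¹ ∈ A ∨ p⁻¹⁻¹ ∈ A := by rw [inv_inv]; exact hp.symm
  have hq' : q⁻¹ ∈ A ∨ q⁻¹⁻¹ ∈ A := by rw [inv_inv]; exact hq.symm
  obtain ⟨K₁, E₁, hdec₁⟩ := dec A hA p q hd
  obtain ⟨K₂, E₂, hdec₂⟩ := dec A hA p⁻¹ q⁻¹ hd'
  obtain ⟨N, hN0, hN⟩ := analytic (K₁ + K₂) (E₁ + E₂) C δ hδ N₀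
  refine ⟨C, D, E₁ + E₂, N, ?_⟩
  intro n hn
  obtain ⟨n', W, hnn, hWw, hWp, hWl, hcor⟩ := hcore n ((by exact_mod_cast hN0 : (N₀ : ℤ) ≤ N).trans hn)
  refine ⟨n', hnn, ?_⟩
  intro v hv
  obtain ⟨an1, an2⟩ := hN n (by exact_mod_cast hn)
  have hvn : 0 ≤ |v.1| + |v.2| := by positivity
  obtain ⟨s, hs⟩ := Int.eq_ofNat_of_zero_le hvn
  set M := (K₁ + K₂) * s with hM
  have hsR : (s : ℝ) ≤ (n : ℝ) ^ ((1 : ℝ) / 6) := by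
    rw [hs] at hv; exact_mod_cast hv
  have hMR : (M : ℝ) ≤ ((K₁ + K₂ : ℕ) : ℝ) * (n : ℝ) ^ ((1 : ℝ) / 6) := by
    rw [hM, Nat.cast_mul]; gcongr
  obtain ⟨c1, c2⟩ := hcor M (hMR.trans an1)
  have hy : (n : ℝ) - C ≤ ((|n'| : ℤ) : ℝ) := by
    have h1 := (abs_le.1 hnn).2
    have h2 := le_abs_self n'
    have : n - C ≤ |n'| := by linarith
    exact_mod_cast this
  have hlen : 4 * (M : ℝ) + ((E₁ + E₂ : ℕ) : ℝ) ≤ ((|n'| : ℤ) : ℝ) ^ ((1 : ℝ) / 5) := by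
    have := an2 _ hy
    linarith
  have hlen' : 4 * (M : ℝ) + ((E₁ + E₂ : ℕ) : ℝ) ≤ ((|-n'| : ℤ) : ℝ) ^ ((1 : ℝ) / 5) := by
    rwa [abs_neg]
  have hVw := winv_isWordOn hWw
  have hVp : (winv W).prod = Heis.z ^ (-n') := by rw [winv_prod, hWp, zpow_neg]
  have hVl : (winv W).length ≤ wlen A (Heis.z ^ (-n')) + D := by
    rw [winv_length]
    have := wlen_inv_le A hA (Heis.z ^ (-n'))
    rw [zpow_neg, inv_inv] at this
    rw [zpow_neg]; linarith
  have c1' : ∃ X Y, winv W = X ++ (List.replicate M q⁻¹ ++ (List.replicate M p⁻¹ ++ Y)) := by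
    obtain ⟨X, Y, e⟩ := c1
    exact ⟨_, _, by rw [e, winv_corner]⟩
  have c2' : ∃ X Y, winv W = X ++ (List.replicate M q ++ (List.replicate M p ++ Y)) := by
    obtain ⟨X, Y, e⟩ := c2
    exact ⟨_, _, by rw [e, winv_corner, inv_inv, inv_inv]⟩
  have hMZ : (M : ℤ) = (K₁ + K₂) * (s : ℤ) := by rw [hM]; push_cast; ring
  have hs0 : (0 : ℤ) ≤ s := by positivity
  have hb1 : (K₁ : ℤ) * (|v.1| + |v.2|) ≤ M := by
    rw [hs, hMZ]; push_cast; nlinarith [mul_nonneg (Int.natCast_nonneg K₂) hs0]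
  have hb2 : (K₂ : ℤ) * (|v.1| + |v.2|) ≤ M := by
    rw [hs, hMZ]; push_cast; nlinarith [mul_nonneg (Int.natCast_nonneg K₁) hs0]
  rcases le_total (dt ⟨v.1, v.2, 0⟩ q + dt p ⟨v.1, v.2, 0⟩) 0 with hsgn | hsgn
  · obtain ⟨α, β, f, hf, hfE, hα, hβ, hαβ, e1, e2⟩ := hdec₁ v hsgn
    exact ⟨finish' A W n' hWw hWp D hWl p q hp hq M c1 v α β f hf _ (by omega)
      (hα.trans hb1) (hβ.trans hb1) hαβ e1 e2 hlen,
      finish' A _ _ hVw hVp D hVl q p hq hp M c2' v β α f hf _ (by omega)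
      (hβ.trans hb1) (hα.trans hb1) (by linarith) (by linarith) (by linarith) hlen'⟩
  · obtain ⟨α, β, f, hf, hfE, hα, hβ, hαβ, e1, e2⟩ := hdec₂ v (by
      rw [dt_inv_left, dt_inv_right]; linarith)
    exact ⟨finish' A W n' hWw hWp D hWl p⁻¹ q⁻¹ hp' hq' M c2 v α β f hf _ (by omega)
      (hα.trans hb2) (hβ.trans hb2) hαβ e1 e2 hlen,
      finish' A _ _ hVw hVp D hVl q⁻¹ p⁻¹ hq' hp' M c1' v β α f hf _ (by omega)
      (hβ.trans hb2) (hα.trans hb2) (by linarith) (by linarith) (by linarith) hlen'⟩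

/-- Proposition `polygon`. For every finite generating set `A` of the
discrete Heisenberg group there are `C, D, E ∈ ℤ` such that for every `n ∈ ℤ` there is
`n' ∈ ℤ` with `|n − n'| ≤ C` such that for every `v = (v₁,v₂) ∈ ℤ²` with
`|v₁| + |v₂| ≤ |n|^(1/6)` there exist words `w, w'` in the letters of `A ∪ A⁻¹` with:
(1) `w` represents `z^{n'}`; (2) `l(w) ≤ |z^{n'}|_A + D`; (3) `φ(w') = v`;
(4) `l(w) ≥ l(w') − E`; (5) `w = u ++ w₂` and `w' = u' ++ w₂` share a common terminal
segment with `l(u) + l(u') ≤ |n'|^(1/5)`. -/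
theorem heisenberg_polygon
    (A : Finset Heis) (hA : IsGenSet A) :
    ∃ C D E : ℤ, ∀ n : ℤ, ∃ n' : ℤ, |n - n'| ≤ C ∧
      ∀ v : ℤ × ℤ, ((|v.1| + |v.2| : ℤ) : ℝ) ≤ ((|n| : ℤ) : ℝ) ^ ((1 : ℝ) / 6) →
        ∃ w w' : List Heis,
          IsWordOn A w ∧ IsWordOn A w' ∧
          w.prod = Heis.z ^ n' ∧
          (w.length : ℤ) ≤ (wlen A (Heis.z ^ n') : ℤ) + D ∧
          Heis.φ w'.prod = v ∧
          (w'.length : ℤ) - E ≤ (w.length : ℤ) ∧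
          ∃ u u' w₂ : List Heis, w = u ++ w₂ ∧ w' = u' ++ w₂ ∧
            ((u.length + u'.length : ℕ) : ℝ) ≤ ((|n'| : ℤ) : ℝ) ^ ((1 : ℝ) / 5) := by
  obtain ⟨C, D, E, N, h⟩ := large A hA
  refine ⟨C + 2 * N, D, E, ?_⟩
  intro n
  rcases le_or_gt (N : ℤ) n with h1 | h1
  · obtain ⟨n', hn, hv⟩ := h n h1
    refine ⟨n', by linarith, fun v hvn => ?_⟩
    rw [abs_of_nonneg (show (0:ℤ) ≤ n by linarith [Int.natCast_nonneg N])] at hvn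
    exact (hv v hvn).1
  rcases le_or_gt n (-N) with h2 | h2
  · obtain ⟨n', hn, hv⟩ := h (-n) (by linarith)
    refine ⟨-n', ?_, fun v hvn => ?_⟩
    · rw [abs_le] at hn ⊢; constructor <;> linarith
    · rw [abs_of_nonpos (show n ≤ 0 by linarith [Int.natCast_nonneg N])] at hvn
      exact (hv v hvn).2
  · obtain ⟨n', hn, hv⟩ := h N le_rfl
    refine ⟨n', ?_, fun v hvn => ?_⟩
    · rw [abs_le] at hn ⊢; constructor <;> linarith
    · refine (hv v (hvn.trans ?_)).1
      apply Real.rpow_le_rpow (by positivity) _ (by norm_num)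
      have : |n| ≤ N := abs_le.2 ⟨h2.le, h1.le⟩
      exact_mod_cast this
end
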